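/- arXiv:1802.08977 — 5 statements merged into one kernel-verified Lean document; each statement's English description precedes it below -/
import Mathlib

section
/- Let k ≥ 1 and let λ, μ be partitions with at most k parts such that μ ⊆ λ (i.e. μ_i ≤ λ_i for all i). Then Π_{i≥1} binom(λ'_i − μ'_{i+1}, μ'_i − μ'_{i+1}) equals the number of distinct rearrangements α of the k-tuple (μ_1,…,μ_k) (padded with zeros) such that α_i ≤ λ_i for all 1 ≤ i ≤ k. -/
open Finset

/-- The distinct rearrangements of a `k`-tuple of naturals: the distinct tuples
`(a_{w(1)},…,a_{w(k)})` for permutations `w` of `{1,…,k}`, each counted once. -/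
def rearr {k : ℕ} (a : Fin k → ℕ) : Finset (Fin k → ℕ) :=
  Finset.univ.image (fun w : Equiv.Perm (Fin k) => a ∘ w)

/-- `conjP a j` is the `j`-th part of the conjugate partition of the tuple `a`,
i.e. the number of indices `i` with `a i ≥ j`. -/
def conjP {k : ℕ} (a : Fin k → ℕ) (j : ℕ) : ℕ :=
  (Finset.univ.filter fun i => j ≤ a i).card

lemma conjP_succ {k : ℕ} (a : Fin k → ℕ) (n : ℕ) :
    conjP a n = conjP a (n + 1) + (univ.filter fun i => a i = n).card := by
  unfold conjP
  rw [← card_union_of_disjoint]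
  · congr 1
    ext i
    simp only [mem_filter, mem_univ, true_and, mem_union]
    omega
  · rw [disjoint_filter]
    intro i _ h1 h2
    omega

lemma conjP_mono {k : ℕ} {a b : Fin k → ℕ} (n : ℕ) (h : ∀ i, n ≤ a i → n ≤ b i) :
    conjP a n ≤ conjP b n := by
  unfold conjP
  apply card_le_card
  intro i
  simpa using h i

lemma conjP_congr {k : ℕ} {a b : Fin k → ℕ} (n : ℕ) (h : ∀ i, n ≤ a i ↔ n ≤ b i) :
    conjP a n = conjP b n :=
  le_antisymm (conjP_mono n fun i => (h i).1) (conjP_mono n fun i => (h i).2)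

lemma mem_rearr_iff {k : ℕ} (a b : Fin k → ℕ) :
    b ∈ rearr a ↔ ∀ j, 1 ≤ j → conjP b j = conjP a j := by
  constructor
  · intro h j _
    simp only [rearr, mem_image, mem_univ, true_and] at h
    obtain ⟨w, rfl⟩ := h
    unfold conjP
    refine card_bij (fun i _ => w i) ?_ ?_ ?_
    · intro i; simp
    · intro i _ i' _ h; exact w.injective h
    · intro i hi
      exact ⟨w.symm i, by simpa using hi, by simp⟩
  · intro h
    have h0 : ∀ j, conjP b j = conjP a j := by
      intro j
      rcases Nat.eq_zero_or_pos j with rfl | hj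
      · exact conjP_congr 0 (by simp)
      · exact h j hj
    have hc : ∀ v, Nonempty ({i // b i = v} ≃ {i // a i = v}) := by
      intro v
      rw [← Fintype.card_eq, Fintype.card_subtype, Fintype.card_subtype]
      have h1 := conjP_succ a v
      have h2 := conjP_succ b v
      rw [h0, h0] at h2
      omega
    let w : Equiv.Perm (Fin k) := Equiv.ofFiberEquiv (f := b) (g := a) fun v => (hc v).some
    have hw : ∀ i, a (w i) = b i := fun i => Equiv.ofFiberEquiv_map _ i
    simp only [rearr, mem_image, mem_univ, true_and]
    exact ⟨w, funext hw⟩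

/-- Truncated fillings. -/
noncomputable def trS {k : ℕ} (lam mu : Fin k → ℕ) (n : ℕ) : Finset (Fin k → ℕ) :=
  open Classical in
  (Fintype.piFinset fun i => Finset.range (lam i + 1)).filter
    (fun a => (∀ i, a i = 0 ∨ n ≤ a i) ∧ ∀ j, n ≤ j → conjP a j = conjP mu j)

lemma mem_trS {k : ℕ} {lam mu : Fin k → ℕ} {n : ℕ} {a : Fin k → ℕ} :
    a ∈ trS lam mu n ↔ (∀ i, a i ≤ lam i) ∧ (∀ i, a i = 0 ∨ n ≤ a i) ∧
      ∀ j, n ≤ j → conjP a j = conjP mu j := by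
  simp [trS, Nat.lt_succ_iff]

lemma card_fib {k : ℕ} (lam mu : Fin k → ℕ) (n : ℕ) (hn : 1 ≤ n) (b : Fin k → ℕ)
    (hb : b ∈ trS lam mu (n + 1)) :
    ((trS lam mu n).filter fun a => (fun i => if a i = n then 0 else a i) = b).card =
      Nat.choose (conjP lam n - conjP mu (n + 1)) (conjP mu n - conjP mu (n + 1)) := by
  obtain ⟨hb1, hb2, hb3⟩ := mem_trS.1 hb
  have hT : (univ.filter fun i => n ≤ lam i ∧ b i = 0).card =
      conjP lam n - conjP mu (n + 1) := by
    rw [← hb3 (n + 1) le_rfl]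
    apply Nat.eq_sub_of_add_eq
    unfold conjP
    rw [← card_union_of_disjoint]
    · congr 1
      ext i
      simp only [mem_filter, mem_univ, true_and, mem_union]
      have := hb1 i
      have := hb2 i
      omega
    · rw [disjoint_filter]
      intro i _ h1 h2
      omega
  have hmn := conjP_succ mu n
  rw [← hT, ← card_powersetCard]
  refine card_nbij' (fun a => univ.filter fun i => a i = n)
    (fun s i => if i ∈ s then n else b i) ?_ ?_ ?_ ?_
  · intro a ha
    simp only [coe_filter, Set.mem_setOf_eq] at ha
    obtain ⟨ha, rfl⟩ := ha
    obtain ⟨h1, h2, h3⟩ := mem_trS.1 ha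
    simp only [Set.mem_setOf_eq, mem_coe, mem_powersetCard]
    constructor
    · intro i
      simp only [mem_filter, mem_univ, true_and]
      intro h
      have := h1 i
      simp [h]; omega
    · have := conjP_succ a n
      rw [h3 _ le_rfl, h3 (n + 1) (Nat.le_succ n)] at this
      omega
  · intro s hs
    simp only [mem_coe, mem_powersetCard] at hs
    obtain ⟨hs, hc⟩ := hs
    have hs' : ∀ i ∈ s, n ≤ lam i ∧ b i = 0 := fun i hi => by simpa using hs hi
    have hbn : ∀ i, b i ≠ n := fun i => by have := hb2 i; omega
    have hgt : ∀ j, n + 1 ≤ j →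
        conjP (fun i => if i ∈ s then n else b i) j = conjP mu j := by
      intro j hj
      rw [← hb3 j hj]
      apply conjP_congr
      intro i
      by_cases hi : i ∈ s
      · have := hs' i hi
        simp only [hi, if_true]; omega
      · simp [hi]
    simp only [coe_filter, Set.mem_setOf_eq]
    refine ⟨mem_trS.2 ⟨?_, ?_, ?_⟩, ?_⟩
    · intro i
      by_cases hi : i ∈ s
      · simpa [hi] using (hs' i hi).1
      · simpa [hi] using hb1 i
    · intro i
      by_cases hi : i ∈ s
      · simp [hi]
      · have := hb2 i
        simp only [hi, if_false]; omega
    · intro j hj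
      rcases Nat.eq_or_lt_of_le hj with rfl | hj
      · rw [conjP_succ, hgt _ le_rfl]
        have : (univ.filter fun i => (if i ∈ s then n else b i) = n) = s := by
          ext i
          by_cases hi : i ∈ s <;> simp [hi, hbn]
        rw [this, hc]
        omega
      · exact hgt j hj
    · funext i
      by_cases hi : i ∈ s
      · simp [hi, (hs' i hi).2]
      · simp [hi, hbn]
  · intro a ha
    simp only [coe_filter, Set.mem_setOf_eq] at ha
    obtain ⟨ha, rfl⟩ := ha
    funext i
    by_cases hi : a i = n <;> simp [hi]
  · intro s hs
    have hbn : ∀ i, b i ≠ n := fun i => by have := hb2 i; omega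
    ext i
    by_cases hi : i ∈ s <;> simp [hi, hbn]

lemma card_step {k : ℕ} (lam mu : Fin k → ℕ) (n : ℕ) (hn : 1 ≤ n) :
    (trS lam mu n).card =
      Nat.choose (conjP lam n - conjP mu (n + 1)) (conjP mu n - conjP mu (n + 1)) *
        (trS lam mu (n + 1)).card := by
  rw [card_eq_sum_card_fiberwise (f := fun a i => if a i = n then 0 else a i)
    (t := trS lam mu (n + 1)), sum_congr rfl (fun b hb => card_fib lam mu n hn b hb),
    sum_const, smul_eq_mul, mul_comm]
  intro a ha
  obtain ⟨h1, h2, h3⟩ := mem_trS.1 ha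
  refine mem_trS.2 ⟨?_, ?_, ?_⟩
  · intro i
    have := h1 i
    dsimp only
    split_ifs <;> omega
  · intro i
    have := h2 i
    dsimp only
    split_ifs <;> omega
  · intro j hj
    rw [← h3 j (by omega)]
    apply conjP_congr
    intro i
    dsimp only
    split_ifs <;> omega

lemma card_trS {k : ℕ} (lam mu : Fin k → ℕ) (hsub : ∀ i, mu i ≤ lam i) (M : ℕ)
    (hM : ∀ i, lam i ≤ M) (d : ℕ) : ∀ n, 1 ≤ n → n + d = M + 1 →
    (trS lam mu n).card = ∏ j ∈ Finset.Ico n (M + 1),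
      Nat.choose (conjP lam j - conjP mu (j + 1)) (conjP mu j - conjP mu (j + 1)) := by
  induction d with
  | zero =>
    intro n hn h
    obtain rfl : n = M + 1 := by omega
    rw [Finset.Ico_self, prod_empty, card_eq_one]
    refine ⟨fun _ => 0, ?_⟩
    ext a
    rw [mem_trS, mem_singleton]
    constructor
    · rintro ⟨h1, h2, -⟩
      funext i
      have := h1 i
      have := h2 i
      have := hM i
      omega
    · rintro rfl
      refine ⟨by simp, by simp, ?_⟩
      intro j hj
      apply conjP_congr
      intro i
      have := hsub i
      have := hM i
      omega
  | succ d ih =>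
    intro n hn h
    rw [card_step lam mu n hn, ih (n + 1) (by omega) (by omega),
      prod_eq_prod_Ico_succ_bot (a := n) (by omega)]

/-- if `μ ⊆ λ` are partitions with at most `k` parts, then
`Π_{i≥1} binom(λ'_i − μ'_{i+1}, μ'_i − μ'_{i+1})` equals the number of distinct
rearrangements `α` of `μ` with `α_i ≤ λ_i` for all `i`.  (All factors with
`j > λ_1` equal `binom(0,0) = 1`, so the product is truncated at `λ_1 = sup λ`.) -/
theorem stmt_0 (k : ℕ) (hk : 1 ≤ k) (lam mu : Fin k → ℕ)
    (hlam : Antitone lam) (hmu : Antitone mu) (hsub : ∀ i, mu i ≤ lam i) :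
    ∏ j ∈ Finset.Icc 1 (Finset.univ.sup lam),
        Nat.choose (conjP lam j - conjP mu (j + 1)) (conjP mu j - conjP mu (j + 1)) =
      ((rearr mu).filter (fun a => ∀ i, a i ≤ lam i)).card := by
  have h := card_trS lam mu hsub (Finset.univ.sup lam)
    (fun i => Finset.le_sup (f := lam) (mem_univ i)) (Finset.univ.sup lam) 1 le_rfl (by omega)
  have hI : Finset.Icc 1 (Finset.univ.sup lam) = Finset.Ico 1 (Finset.univ.sup lam + 1) := by
    ext j
    simp only [Finset.mem_Icc, Finset.mem_Ico]
    omega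
  rw [hI, ← h]
  congr 1
  ext a
  rw [mem_trS, mem_filter, mem_rearr_iff]
  have h0 : ∀ i, a i = 0 ∨ 1 ≤ a i := fun i => by omega
  tauto
end

section
/- For k ≥ 2, the subgroup of the group of bijections ℤ→ℤ (under composition) generated by {τ, σ_0, σ_1, …, σ_{k−1}} is exactly the set of bijections ŵ: ℤ→ℤ such that ŵ(m+k) = ŵ(m)+k for all m ∈ ℤ and Σ_{m=1}^k (ŵ(m) − m) ≡ 0 (mod k). -/
open Finset

/-- The shift `τ(m) = m − 1`. -/
def tauFun : ℤ → ℤ := fun m => m - 1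

/-- The simple affine reflection `σ_i` as a map `ℤ → ℤ`:
`σ_i(m) = m+1` if `m ≡ i (mod k)`, `σ_i(m) = m−1` if `m ≡ i+1 (mod k)`, else `m`. -/
def sigmaFun (k i : ℕ) : ℤ → ℤ := fun m =>
  if m % (k : ℤ) = (i : ℤ) % (k : ℤ) then m + 1
  else if m % (k : ℤ) = ((i : ℤ) + 1) % (k : ℤ) then m - 1
  else m


theorem sig_dvd (k i : ℕ) (m : ℤ) : sigmaFun k i m =
    if (k : ℤ) ∣ m - i then m + 1 else if (k : ℤ) ∣ m - i - 1 then m - 1 else m := by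
  have h1 : (m % (k : ℤ) = (i : ℤ) % (k : ℤ)) ↔ (k : ℤ) ∣ m - i :=
    Int.emod_eq_emod_iff_emod_sub_eq_zero.trans Int.dvd_iff_emod_eq_zero.symm
  have h2 : (m % (k : ℤ) = ((i : ℤ) + 1) % (k : ℤ)) ↔ (k : ℤ) ∣ m - i - 1 := by
    rw [sub_sub]
    exact Int.emod_eq_emod_iff_emod_sub_eq_zero.trans Int.dvd_iff_emod_eq_zero.symm
  simp only [sigmaFun, h1, h2]

theorem not_dvd_one {k : ℕ} (hk : 2 ≤ k) {a b : ℤ} (h : (k : ℤ) ∣ a) (h' : (k : ℤ) ∣ b) :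
    a - b ≠ 1 := by
  intro e
  have := Int.dvd_sub h h'
  rw [e] at this
  have := Int.le_of_dvd one_pos this
  omega

theorem sig_invol (k i : ℕ) (hk : 2 ≤ k) (m : ℤ) : sigmaFun k i (sigmaFun k i m) = m := by
  rw [sig_dvd k i m]
  split_ifs with h1 h2
  · rw [sig_dvd, if_neg, if_pos]
    · ring
    · convert h1 using 1; ring
    · intro h; exact not_dvd_one hk h h1 (by ring)
  · rw [sig_dvd, if_pos]
    · ring
    · convert h2 using 1; ring
  · rw [sig_dvd, if_neg h1, if_neg h2]

def sigPerm (k i : ℕ) (hk : 2 ≤ k) : Equiv.Perm ℤ :=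
  ⟨sigmaFun k i, sigmaFun k i, sig_invol k i hk, sig_invol k i hk⟩

def shiftPerm : Equiv.Perm ℤ := ⟨fun m => m - 1, fun m => m + 1, fun m => by simp, fun m => by simp⟩

theorem sig_per (k i : ℕ) (m : ℤ) : sigmaFun k i (m + k) = sigmaFun k i m + k := by
  simp only [sigmaFun, Int.add_emod_right]
  split_ifs <;> ring

def perGroup (k : ℕ) : Subgroup (Equiv.Perm ℤ) where
  carrier := {w | ∀ m : ℤ, w (m + k) = w m + k}
  mul_mem' := by
    intro a b ha hb m
    simp only [Set.mem_setOf_eq] at ha hb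
    simp [hb, ha]
  one_mem' := by intro m; simp
  inv_mem' := by
    intro a ha m
    simp only [Set.mem_setOf_eq] at ha
    apply a.injective
    rw [ha]; simp

theorem per_mul {k : ℕ} {w : ℤ → ℤ} (h : ∀ m : ℤ, w (m + k) = w m + k) (t m : ℤ) :
    w (m + k * t) = w m + k * t := by
  induction t using Int.induction_on with
  | zero => simp
  | succ n ih =>
    have := h (m + k * n)
    rw [show m + (k : ℤ) * (n + 1) = m + k * n + k by ring, this, ih]; ring
  | pred n ih =>
    have := h (m + k * (-n - 1))
    rw [show m + (k : ℤ) * (-n - 1) + k = m + k * (-n) by ring, ih] at this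
    linarith

theorem div_sum {k : ℕ} (hk : 2 ≤ k) (w : Equiv.Perm ℤ) (h : ∀ m : ℤ, w (m + k) = w m + k) :
    (k : ℤ) ∣ ∑ m ∈ Finset.Icc (1 : ℤ) (k : ℤ), (w m - m) := by
  have hk0 : (0 : ℤ) < k := by omega
  set f : ℤ → ℤ := fun m => (w m - 1) % k + 1 with hf
  have hmaps : Set.MapsTo f (Finset.Icc (1 : ℤ) k) (Finset.Icc (1 : ℤ) k) := by
    intro m _
    have := Int.emod_nonneg (w m - 1) hk0.ne'
    have := Int.emod_lt_of_pos (w m - 1) hk0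
    simp only [hf, Finset.coe_Icc, Set.mem_Icc]
    omega
  have hinj : Set.InjOn f (Finset.Icc (1 : ℤ) k) := by
    intro a ha b hb hab
    simp only [Finset.coe_Icc, Set.mem_Icc] at ha hb
    have h1 : (w a - 1) % k = (w b - 1) % k := by simpa [hf] using hab
    have h2 : (k : ℤ) ∣ (w a - 1) - (w b - 1) :=
      Int.dvd_of_emod_eq_zero (Int.emod_eq_emod_iff_emod_sub_eq_zero.1 h1)
    obtain ⟨t, ht⟩ := h2
    have h3 : w a = w (b + k * t) := by rw [per_mul h]; linarith
    have h4 := w.injective h3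
    have h5 : t = 0 := by
      have : (k : ℤ) * t < k * 1 := by linarith
      have := lt_of_mul_lt_mul_left this hk0.le
      have : (k : ℤ) * (-1) < k * t := by linarith
      have := lt_of_mul_lt_mul_left this hk0.le
      omega
    simpa [h5] using h4
  have hsum : ∑ m ∈ Finset.Icc (1 : ℤ) k, f m = ∑ m ∈ Finset.Icc (1 : ℤ) k, m :=
    Finset.sum_nbij f hmaps hinj
      (Finset.surjOn_of_injOn_of_card_le f hmaps hinj le_rfl) (fun _ _ => rfl)
  rw [Finset.sum_sub_distrib, ← hsum, ← Finset.sum_sub_distrib]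
  apply Finset.dvd_sum
  intro m _
  refine ⟨(w m - 1) / k, ?_⟩
  have := Int.emod_add_mul_ediv (w m - 1) k
  simp only [hf]; linarith

def win (k : ℕ) (w : ℤ → ℤ) (a : ℤ) : ℤ := ∑ j ∈ Finset.range k, (w (a + j) - (a + j)) ^ 2

theorem win_shift {k : ℕ} {w : ℤ → ℤ} (h : ∀ m : ℤ, w (m + k) = w m + k) (a : ℤ) :
    win k w (a + 1) = win k w a := by
  have h1 := Finset.sum_range_succ (fun j : ℕ => (w (a + j) - (a + j)) ^ 2) k
  have h2 := Finset.sum_range_succ' (fun j : ℕ => (w (a + j) - (a + j)) ^ 2) k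
  have h3 : win k w (a + 1) =
      ∑ j ∈ Finset.range k, (w (a + (j + 1 : ℕ)) - (a + (j + 1 : ℕ))) ^ 2 := by
    apply Finset.sum_congr rfl
    intro j _
    rw [show a + 1 + (j : ℤ) = a + (j + 1 : ℕ) by push_cast; ring]
  rw [h1, h, ← h3] at h2
  simp only [Nat.cast_zero, add_zero] at h2
  rw [show w a + (k : ℤ) - (a + k) = w a - a by ring] at h2
  unfold win at *
  linarith

theorem win_const {k : ℕ} {w : ℤ → ℤ} (h : ∀ m : ℤ, w (m + k) = w m + k) (a : ℤ) :
    win k w a = win k w 0 := by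
  induction a using Int.induction_on with
  | zero => rfl
  | succ n ih => rw [win_shift h, ih]
  | pred n ih => rw [← ih, ← win_shift h (-n - 1)]; congr 1; ring

theorem win_lt {k : ℕ} (hk : 2 ≤ k) (w : Equiv.Perm ℤ) (a : ℤ) (i : ℕ)
    (hi : (k : ℤ) ∣ a - i) (hlt : w (a + 1) < w a) :
    win k (w * sigPerm k i hk : Equiv.Perm ℤ) a < win k w a := by
  obtain ⟨n, rfl⟩ := Nat.exists_eq_add_of_le' hk
  have e0 : sigmaFun (n + 2) i a = a + 1 := by rw [sig_dvd, if_pos hi]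
  have e1 : sigmaFun (n + 2) i (a + 1) = a := by rw [← e0, sig_invol _ _ hk]
  have ej : ∀ j < n, sigmaFun (n + 2) i (a + (j + 1 + 1 : ℕ)) = a + (j + 1 + 1 : ℕ) := by
    intro j hj
    rw [sig_dvd, if_neg, if_neg]
    · intro h
      have := Int.dvd_sub h hi
      have := Int.le_of_dvd (by push_cast; omega) this
      push_cast at this; omega
    · intro h
      have := Int.dvd_sub h hi
      have := Int.le_of_dvd (by push_cast; omega) this
      push_cast at this; omega
  have hs : ∀ m, (w * sigPerm (n + 2) i hk : Equiv.Perm ℤ) m = w (sigmaFun (n + 2) i m) :=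
    fun m => rfl
  simp only [win, hs]
  rw [Finset.sum_range_succ', Finset.sum_range_succ', Finset.sum_range_succ',
    Finset.sum_range_succ']
  have hr : ∑ j ∈ Finset.range n, (w (sigmaFun (n + 2) i (a + (j + 1 + 1 : ℕ)))
        - (a + (j + 1 + 1 : ℕ))) ^ 2
      = ∑ j ∈ Finset.range n, (w (a + (j + 1 + 1 : ℕ)) - (a + (j + 1 + 1 : ℕ))) ^ 2 := by
    apply Finset.sum_congr rfl
    intro j hj
    rw [ej j (Finset.mem_range.1 hj)]
  rw [hr]
  simp only [zero_add, Nat.cast_zero, Nat.cast_one, add_zero, e0, e1]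
  nlinarith

theorem mono_shift (w : Equiv.Perm ℤ) (h : ∀ m, w m < w (m + 1)) (m : ℤ) : w m = m + w 0 := by
  have hm : StrictMono w := strictMono_int_of_lt_succ h
  have hs : ∀ m, w (m + 1) = w m + 1 := by
    intro m
    obtain ⟨x, hx⟩ := w.surjective (w m + 1)
    have h1 : m < x := hm.lt_iff_lt.1 (by omega)
    have h2 : w (m + 1) ≤ w x := hm.monotone (by omega)
    have := h m
    omega
  induction m using Int.induction_on with
  | zero => simp
  | succ n ih => rw [hs, ih]; ring
  | pred n ih =>
    have := hs (-n - 1)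
    rw [show (-n - 1 + 1 : ℤ) = -n by ring, ih] at this
    linarith

theorem shift_zpow (t m : ℤ) : (shiftPerm ^ t) m = m - t := by
  induction t using Int.induction_on generalizing m with
  | zero => simp
  | succ n ih =>
    rw [zpow_add_one, Equiv.Perm.mul_apply, ih]
    change m - 1 - _ = _
    ring
  | pred n ih =>
    rw [zpow_sub_one, Equiv.Perm.mul_apply, ih]
    change m + 1 - _ = _
    ring

theorem mem_of_per {k : ℕ} (hk : 2 ≤ k) (G : Subgroup (Equiv.Perm ℤ)) (ht : shiftPerm ∈ G)
    (hG : ∀ i < k, sigPerm k i hk ∈ G) (N : ℕ) : ∀ (w : Equiv.Perm ℤ),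
    (∀ m : ℤ, w (m + k) = w m + k) → win k w 0 < N → w ∈ G := by
  induction N with
  | zero =>
    intro w _ h
    have : 0 ≤ win k w 0 := Finset.sum_nonneg fun _ _ => sq_nonneg _
    simp at h; omega
  | succ N ih =>
    intro w hw hN
    by_cases hm : ∀ m, w m < w (m + 1)
    · have : w = shiftPerm ^ (-(w 0)) := by
        ext m
        rw [shift_zpow, mono_shift w hm m]; ring
      rw [this]
      exact G.zpow_mem ht _
    · push Not at hm
      obtain ⟨a, ha⟩ := hm
      have hne : w (a + 1) ≠ w a := fun h => by have := w.injective h; omega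
      have hlt := lt_of_le_of_ne ha hne
      have hk0 : (0 : ℤ) < k := by omega
      have n1 := Int.emod_nonneg a hk0.ne'
      have n2 := Int.emod_lt_of_pos a hk0
      have hc : (((a % k).toNat : ℕ) : ℤ) = a % k := Int.toNat_of_nonneg n1
      have hi : (k : ℤ) ∣ a - ((a % k).toNat : ℕ) := by
        rw [hc]; exact Int.dvd_self_sub_emod
      have hik : (a % k).toNat < k := by omega
      have key := win_lt hk w a _ hi hlt
      have hp : ∀ m : ℤ, (w * sigPerm k (a % k).toNat hk : Equiv.Perm ℤ) (m + k)
          = (w * sigPerm k (a % k).toNat hk : Equiv.Perm ℤ) m + k := by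
        intro m
        change w (sigmaFun k _ (m + k)) = w (sigmaFun k _ m) + k
        rw [sig_per, hw]
      rw [win_const hp, win_const hw] at key
      have := ih _ hp (by push_cast at hN; omega)
      exact (G.mul_mem_cancel_right (hG _ hik)).1 this

/-- for `k ≥ 2`, the subgroup of the group of bijections `ℤ → ℤ`
generated by `{τ, σ_0, …, σ_{k−1}}` is exactly the set of bijections `ŵ` with
`ŵ(m+k) = ŵ(m) + k` for all `m` and `Σ_{m=1}^k (ŵ(m) − m) ≡ 0 (mod k)`. -/
theorem stmt_5 (k : ℕ) (hk : 2 ≤ k) :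
    (Subgroup.closure
        {w : Equiv.Perm ℤ |
          (∀ m : ℤ, w m = tauFun m) ∨ ∃ i < k, ∀ m : ℤ, w m = sigmaFun k i m} :
        Set (Equiv.Perm ℤ)) =
      {w : Equiv.Perm ℤ |
        (∀ m : ℤ, w (m + k) = w m + k) ∧
        (k : ℤ) ∣ ∑ m ∈ Finset.Icc (1 : ℤ) (k : ℤ), (w m - m)} := by
  ext w
  simp only [SetLike.mem_coe, Set.mem_setOf_eq]
  constructor
  · intro h
    have h' : w ∈ perGroup k := by
      refine (Subgroup.closure_le (perGroup k)).2 ?_ h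
      rintro v (hv | ⟨i, _, hv⟩) m
      · simp only [hv, tauFun]; ring
      · simp only [hv, sig_per]
    exact ⟨h', div_sum hk w h'⟩
  · rintro ⟨h, _⟩
    refine mem_of_per hk _ (Subgroup.subset_closure (Or.inl fun m => rfl))
      (fun i hi => Subgroup.subset_closure (Or.inr ⟨i, hi, fun m => rfl⟩))
      ((win k w 0).toNat + 1) w h ?_
    push_cast
    have := Int.self_le_toNat (win k w 0)
    omega
end

section
/- Let n, k ≥ 1, let λ, μ ∈ A_{k,n} and let ν be a partition with at most k parts such that n divides |μ|+|ν|−|λ|. Let ν̌ ∈ A_{k,n} be the unique alcove point in the orbit under Ĝ_k of the extension of ν to P_{k,n} (via ν_{i+k} = ν_i − n). Then N_{μν}^λ = N_{μν̌}^λ · multinomial(m_n(ν̌); m_0(ν), m_n(ν), m_{2n}(ν), …) · Π_{i=1}^{n−1} multinomial(m_i(ν̌); m_i(ν), m_{i+n}(ν), m_{i+2n}(ν), …), where m_j(·) denotes the number of entries equal to j among the k entries (ν padded with zeros to a k-tuple) and multinomial(m; a_0, a_1, …) = m!/(a_0! a_1! ⋯). -/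
open Finset

/-- The quasi-periodic extension of a `k`-tuple `a` to a function `ℤ → ℤ` satisfying
`λ_{i+k} = λ_i − n`, with `λ_i = a_i` for `1 ≤ i ≤ k`. -/
def extend (n k : ℕ) (hk : 0 < k) (a : Fin k → ℕ) : ℤ → ℤ :=
  fun i =>
    (a ⟨((i - 1) % (k : ℤ)).toNat, by
        have hk' : (0 : ℤ) < (k : ℤ) := by exact_mod_cast hk
        have h1 : 0 ≤ (i - 1) % (k : ℤ) := Int.emod_nonneg _ (ne_of_gt hk')
        have h2 : (i - 1) % (k : ℤ) < (k : ℤ) := Int.emod_lt_of_pos _ hk'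
        omega⟩ : ℤ) - n * ((i - 1) / (k : ℤ))

/-- The alcove `A_{k,n}`, encoded by the `k`-tuples `(λ_1,…,λ_k)` with
`n ≥ λ_1 ≥ ⋯ ≥ λ_k > 0`. -/
def alcoveFinset (n k : ℕ) : Finset (Fin k → ℕ) :=
  (Fintype.piFinset fun _ : Fin k => Finset.Icc 1 n).filter
    (fun a => ∀ i j : Fin k, i ≤ j → a j ≤ a i)

/-- The fusion coefficient `N_{αβ}^γ`. -/
noncomputable def fusionN (n k : ℕ) (al be ga : Fin k → ℕ) : ℕ := by
  classical exact
  (((rearr al) ×ˢ (rearr be)).filter fun p =>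
    ∃ c : Fin k → ℤ,
      (∀ i, ((p.1 i : ℤ) + (p.2 i : ℤ)) = (ga i : ℤ) + (n : ℤ) * c i) ∧
      (n : ℤ) * (∑ i, c i) =
        (∑ i, (al i : ℤ)) + (∑ i, (be i : ℤ)) - (∑ i, (ga i : ℤ))).card

/-- `m_j(a)`: the multiplicity of the part `j` among the `k` entries of the tuple `a`. -/
def multCnt {k : ℕ} (a : Fin k → ℕ) (j : ℕ) : ℕ :=
  (Finset.univ.filter fun i => a i = j).card

def redu (n x : ℕ) : ℕ := if x % n = 0 then n else x % n

lemma redu_mod (n x : ℕ) : redu n x % n = x % n := by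
  unfold redu
  split_ifs with h
  · simp [h]
  · exact Nat.mod_mod _ _

lemma redu_mem (n x : ℕ) (hn : 1 ≤ n) : redu n x ∈ Finset.Icc 1 n := by
  unfold redu
  have := Nat.mod_lt x hn
  rw [Finset.mem_Icc]
  split_ifs with h <;> omega

lemma eq_of_mem_mod (n x y : ℕ) (hx : x ∈ Finset.Icc 1 n) (hy : y ∈ Finset.Icc 1 n)
    (h : x % n = y % n) : x = y := by
  rw [Finset.mem_Icc] at hx hy
  rcases eq_or_lt_of_le hx.2 with rfl | h1 <;> rcases eq_or_lt_of_le hy.2 with h2 | h2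
  · exact h2.symm
  · rw [Nat.mod_self, Nat.mod_eq_of_lt h2] at h; omega
  · subst h2; rw [Nat.mod_self, Nat.mod_eq_of_lt h1] at h; omega
  · rwa [Nat.mod_eq_of_lt h1, Nat.mod_eq_of_lt h2] at h

lemma stab_card {k : ℕ} (f : Fin k → ℕ) (s : Equiv.Perm (Fin k)) (S : Finset ℕ)
    (hS : ∀ i, f i ∈ S) :
    (Finset.univ.filter fun w : Equiv.Perm (Fin k) => f ∘ w = f ∘ s).card
      = ∏ v ∈ S, (multCnt f v).factorial := by
  classical
  have h1 : (Finset.univ.filter fun w : Equiv.Perm (Fin k) => f ∘ w = f ∘ s).card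
      = (Finset.univ.filter fun w : Equiv.Perm (Fin k) => f ∘ w = f).card := by
    refine Finset.card_bij' (fun w _ => w * s⁻¹) (fun w _ => w * s) ?_ ?_ ?_ ?_
    · intro w hw
      simp only [Finset.mem_filter, Finset.mem_univ, true_and] at hw ⊢
      funext i
      have := congrFun hw (s⁻¹ i)
      simpa using this
    · intro w hw
      simp only [Finset.mem_filter, Finset.mem_univ, true_and] at hw ⊢
      funext i
      have := congrFun hw (s i)
      simpa using this
    · intro w _; simp
    · intro w _; simp
  let g : Fin k → S := fun i => ⟨f i, hS i⟩
  have h2 := DomMulAct.stabilizer_card g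
  rw [h1, ← Fintype.card_subtype]
  have h3 : Fintype.card {w : Equiv.Perm (Fin k) // f ∘ w = f}
      = Fintype.card {w : Equiv.Perm (Fin k) // g ∘ w = g} := by
    refine Fintype.card_congr (Equiv.subtypeEquivRight ?_)
    intro w
    simp [funext_iff, g]
  rw [h3, h2, ← Finset.prod_coe_sort S]
  refine Finset.prod_congr rfl ?_
  intro v _
  rw [Fintype.card_subtype]
  simp [multCnt, g, Subtype.ext_iff]

lemma mem_rearr {k : ℕ} (a b : Fin k → ℕ) :
    b ∈ rearr a ↔ ∃ w : Equiv.Perm (Fin k), a ∘ w = b := by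
  simp [rearr]

/-- the set counted by the fusion coefficient -/
def fset (n k : ℕ) (al be ga : Fin k → ℕ) : Finset ((Fin k → ℕ) × (Fin k → ℕ)) :=
  ((rearr al) ×ˢ (rearr be)).filter fun p => ∀ i, (p.1 i + p.2 i) % n = ga i % n

lemma sum_rearr {k : ℕ} (a b : Fin k → ℕ) (h : b ∈ rearr a) :
    ∑ i, (b i : ℤ) = ∑ i, (a i : ℤ) := by
  obtain ⟨w, rfl⟩ := (mem_rearr a b).1 h
  exact Equiv.sum_comp w (fun i => (a i : ℤ))

lemma fusionN_eq (n k : ℕ) (al be ga : Fin k → ℕ) :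
    fusionN n k al be ga = (fset n k al be ga).card := by
  classical
  unfold fusionN fset
  refine congrArg Finset.card (Finset.filter_congr ?_)
  rintro ⟨a, b⟩ hp
  rw [Finset.mem_product] at hp
  have ha := sum_rearr al a hp.1
  have hb := sum_rearr be b hp.2
  simp only
  constructor
  · rintro ⟨c, hc, -⟩ i
    have := hc i
    zify
    rw [this]
    simp
  · intro h
    have h' : ∀ i, ∃ c : ℤ, (a i : ℤ) + (b i : ℤ) = (ga i : ℤ) + (n : ℤ) * c := by
      intro i
      have h1 := h i
      zify at h1
      obtain ⟨c, hc⟩ := Int.ModEq.dvd (show (ga i : ℤ) ≡ (a i : ℤ) + b i [ZMOD n] from h1.symm)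
      exact ⟨c, by linarith⟩
    choose c hc using h'
    refine ⟨c, hc, ?_⟩
    rw [← ha, ← hb, Finset.mul_sum, ← Finset.sum_add_distrib, ← Finset.sum_sub_distrib]
    refine Finset.sum_congr rfl fun i _ => ?_
    rw [hc i]; ring

lemma orbit_perm (n k : ℕ) (hn : 1 ≤ n) (hk : 0 < k) (nu nuc : Fin k → ℕ)
    (hnuc : nuc ∈ alcoveFinset n k)
    (horbit : ∃ w : ℤ → ℤ, Function.Bijective w ∧ (∀ m : ℤ, w (m + k) = w m + k) ∧
      extend n k hk nuc = (extend n k hk nu) ∘ w) :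
    ∃ s : Equiv.Perm (Fin k), nuc = (redu n ∘ nu) ∘ s := by
  obtain ⟨w, hw, hper, he⟩ := horbit
  have hk' : (0 : ℤ) < (k : ℤ) := by exact_mod_cast hk
  have hlt : ∀ i : ℤ, ((i - 1) % (k : ℤ)).toNat < k := by
    intro i
    have h1 : 0 ≤ (i - 1) % (k : ℤ) := Int.emod_nonneg _ (ne_of_gt hk')
    have h2 : (i - 1) % (k : ℤ) < (k : ℤ) := Int.emod_lt_of_pos _ hk'
    omega
  let p : ℤ → Fin k := fun i => ⟨((i - 1) % (k : ℤ)).toNat, hlt i⟩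
  have hpv : ∀ i, ((p i : ℕ) : ℤ) = (i - 1) % (k : ℤ) := by
    intro i
    exact Int.toNat_of_nonneg (Int.emod_nonneg _ (ne_of_gt hk'))
  have hext : ∀ (a : Fin k → ℕ) i, extend n k hk a i = (a (p i) : ℤ) - n * ((i - 1) / (k : ℤ)) :=
    fun a i => rfl
  let s0 : Fin k → Fin k := fun i => p (w ((i : ℕ) + 1))
  have hmul : ∀ (t m : ℤ), w (m + t * k) = w m + t * k := by
    intro t
    induction t using Int.induction_on with
    | zero => simp
    | succ t ih =>
      intro m
      have := hper (m + t * k)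
      rw [ih] at this
      rw [show m + ((t : ℤ) + 1) * k = m + t * k + k by ring, this]; ring
    | pred t ih =>
      intro m
      have := hper (m + (-(t : ℤ) - 1) * k)
      rw [show m + (-(t : ℤ) - 1) * k + k = m + -(t : ℤ) * k by ring, ih] at this
      linarith
  have hinj : Function.Injective s0 := by
    intro i j hij
    have h1 := hpv (w ((i : ℕ) + 1))
    have h2 := hpv (w ((j : ℕ) + 1))
    have h3 : (w ((i : ℕ) + 1) - 1) % (k : ℤ) = (w ((j : ℕ) + 1) - 1) % (k : ℤ) := by
      rw [← h1, ← h2]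
      exact congrArg (fun x : Fin k => ((x : ℕ) : ℤ)) hij
    obtain ⟨t, ht⟩ := Int.ModEq.dvd (show _ ≡ _ [ZMOD (k : ℤ)] from h3)
    have h4 : w ((j : ℕ) + 1) = w (((i : ℕ) : ℤ) + 1 + t * k) := by
      rw [hmul]; linarith
    have h5 := hw.1 h4
    have h6 : ((j : ℕ) : ℤ) = (i : ℕ) + t * k := by linarith
    have hi := i.2
    have hj := j.2
    have h7 : ((j : ℕ) : ℤ) % k = ((i : ℕ) : ℤ) % k := by rw [h6]; simp
    norm_cast at h7
    rw [Nat.mod_eq_of_lt hi, Nat.mod_eq_of_lt hj] at h7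
    exact Fin.ext h7.symm
  refine ⟨Equiv.ofBijective s0 (Finite.injective_iff_bijective.1 hinj), ?_⟩
  funext i
  have hm := Fintype.mem_piFinset.1 (Finset.mem_filter.1 hnuc).1 i
  refine eq_of_mem_mod n _ _ hm (redu_mem n _ hn) ?_
  show nuc i % n = redu n (nu (s0 i)) % n
  rw [redu_mod]
  have h1 := congrFun he ((i : ℕ) + 1)
  simp only [Function.comp] at h1
  rw [hext, hext] at h1
  have h2 : p ((i : ℕ) + 1) = i := by
    apply Fin.ext
    have := hpv ((i : ℕ) + 1)
    zify
    rw [this, add_sub_cancel_right]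
    exact_mod_cast Nat.mod_eq_of_lt i.2
  rw [h2] at h1
  have h3 : (nuc i : ℤ) = nu (s0 i) + n * (((i : ℕ) + 1 - 1 : ℤ) / k
      - (w ((i : ℕ) + 1) - 1) / k) := by
    have : (nu (s0 i) : ℤ) = nu (p (w ((i : ℕ) + 1))) := rfl
    rw [this]; linarith
  zify
  rw [h3]
  simp

lemma fiber_card {k : ℕ} (nu be : Fin k → ℕ) (r : ℕ → ℕ) (hbe : be ∈ rearr (r ∘ nu))
    (S T : Finset ℕ) (hS : ∀ i, nu i ∈ S) (hT : ∀ i, r (nu i) ∈ T) :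
    ((rearr nu).filter fun b => r ∘ b = be).card * ∏ v ∈ S, (multCnt nu v).factorial
      = ∏ v ∈ T, (multCnt (r ∘ nu) v).factorial := by
  classical
  obtain ⟨s, hs⟩ := (mem_rearr _ _).1 hbe
  rw [← stab_card (r ∘ nu) s T hT]
  rw [Finset.card_eq_sum_card_fiberwise (f := fun w : Equiv.Perm (Fin k) => nu ∘ w)
    (t := (rearr nu).filter fun b => r ∘ b = be)]
  · rw [Finset.sum_const_nat (m := ∏ v ∈ S, (multCnt nu v).factorial)]
    intro b hb
    rw [Finset.mem_filter] at hb
    obtain ⟨s', hs'⟩ := (mem_rearr _ _).1 hb.1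
    rw [← stab_card nu s' S hS, Finset.filter_filter]
    refine congrArg Finset.card (Finset.filter_congr ?_)
    intro w _
    rw [hs', hs]
    constructor
    · exact fun h => h.2
    · intro h
      refine ⟨?_, h⟩
      rw [Function.comp_assoc, h, hb.2]
  · intro w hw
    simp only [Finset.coe_filter, Finset.mem_univ, true_and, Set.mem_ofPred_eq] at hw ⊢
    exact ⟨(mem_rearr _ _).2 ⟨w, rfl⟩, by rw [← Function.comp_assoc, hw, hs]⟩

lemma fset_card (n k : ℕ) (mu nu lam nuc : Fin k → ℕ) (C : ℕ) (s : Equiv.Perm (Fin k))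
    (hs : nuc = (redu n ∘ nu) ∘ s)
    (hC : ∀ be ∈ rearr nuc, ((rearr nu).filter fun b => redu n ∘ b = be).card = C) :
    (fset n k mu nu lam).card = (fset n k mu nuc lam).card * C := by
  classical
  rw [Finset.card_eq_sum_card_fiberwise (f := fun p => (p.1, redu n ∘ p.2))
    (t := fset n k mu nuc lam)]
  · apply Finset.sum_const_nat
    rintro ⟨a, be⟩ hp
    simp only [fset, Finset.mem_filter, Finset.mem_product] at hp
    rw [← hC be hp.1.2]
    refine Finset.card_bij' (fun p _ => p.2) (fun b _ => (a, b)) ?_ ?_ ?_ ?_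
    · rintro ⟨a', b⟩ h
      simp only [fset, Finset.mem_filter, Finset.mem_product, Prod.mk.injEq] at h ⊢
      exact ⟨h.1.1.2, h.2.2⟩
    · intro b h
      simp only [fset, Finset.mem_filter, Finset.mem_product, Prod.mk.injEq, true_and] at h ⊢
      refine ⟨⟨⟨hp.1.1, h.1⟩, ?_⟩, h.2⟩
      intro i
      rw [← hp.2 i, ← h.2]
      simp only [Function.comp]
      rw [Nat.add_mod, Nat.add_mod (a i) (redu n (b i)), redu_mod]
    · rintro ⟨a', b⟩ h
      simp only [fset, Finset.mem_filter, Finset.mem_product, Prod.mk.injEq] at h ⊢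
      exact ⟨h.2.1.symm, trivial⟩
    · intro b h; rfl
  · rintro ⟨a, b⟩ h
    simp only [fset, Finset.coe_filter, Finset.mem_product, Set.mem_ofPred_eq] at h ⊢
    refine ⟨⟨h.1.1, ?_⟩, ?_⟩
    · obtain ⟨w, hw⟩ := (mem_rearr _ _).1 h.1.2
      refine (mem_rearr _ _).2 ⟨s⁻¹ * w, ?_⟩
      subst hs
      funext i
      simp [← hw]
    · intro i
      rw [← h.2 i]
      simp only [Function.comp]
      rw [Nat.add_mod, redu_mod, ← Nat.add_mod]

/-- for `λ, μ ∈ A_{k,n}` and a partition `ν` with at most `k` parts with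
`n ∣ |μ|+|ν|−|λ|`, and `ν̌ ∈ A_{k,n}` the unique alcove point in the `Ĝ_k`-orbit of the
extension of `ν`, one has
`N_{μν}^λ = N_{μν̌}^λ · multinomial(m_n(ν̌); m_0(ν), m_n(ν), m_{2n}(ν), …)
  · Π_{i=1}^{n−1} multinomial(m_i(ν̌); m_i(ν), m_{i+n}(ν), …)`,
where `multinomial(m; a_0, a_1, …) = m!/(a_0!a_1!⋯)`.  (The products over `j ≥ 0` are
truncated at the largest part of `ν`; all further factors are `0! = 1`.) -/
theorem stmt_11 (n k : ℕ) (hn : 1 ≤ n) (hk : 0 < k) (lam mu nu nuc : Fin k → ℕ)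
    (hlam : lam ∈ alcoveFinset n k) (hmu : mu ∈ alcoveFinset n k)
    (hnu : ∀ i j : Fin k, i ≤ j → nu j ≤ nu i)
    (hdvd : (n : ℤ) ∣ ((∑ i, (mu i : ℤ)) + (∑ i, (nu i : ℤ)) - (∑ i, (lam i : ℤ))))
    (hnuc : nuc ∈ alcoveFinset n k)
    (horbit : ∃ w : ℤ → ℤ, Function.Bijective w ∧ (∀ m : ℤ, w (m + k) = w m + k) ∧
      extend n k hk nuc = (extend n k hk nu) ∘ w) :
    fusionN n k mu nu lam =
      fusionN n k mu nuc lam *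
        ((multCnt nuc n).factorial /
          ∏ j ∈ Finset.range (Finset.univ.sup nu + 1), (multCnt nu (j * n)).factorial) *
        ∏ i ∈ Finset.Icc 1 (n - 1),
          ((multCnt nuc i).factorial /
            ∏ j ∈ Finset.range (Finset.univ.sup nu + 1), (multCnt nu (i + j * n)).factorial) := by
  classical
  obtain ⟨s, hs⟩ := orbit_perm n k hn hk nu nuc hnuc horbit
  have hrc : ∀ be, be ∈ rearr nuc → be ∈ rearr (redu n ∘ nu) := by
    intro be h
    obtain ⟨w, hw⟩ := (mem_rearr _ _).1 h
    refine (mem_rearr _ _).2 ⟨s * w, ?_⟩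
    rw [← hw, hs]; rfl
  have hmc : ∀ v, multCnt (redu n ∘ nu) v = multCnt nuc v := by
    intro v
    unfold multCnt
    refine Finset.card_bij' (fun i _ => s⁻¹ i) (fun i _ => s i) ?_ ?_ ?_ ?_ <;>
      simp [hs]
  set M := Finset.univ.sup nu + 1 with hM
  have hle : ∀ i, nu i < M := fun i =>
    Nat.lt_succ_of_le (Finset.le_sup (f := nu) (Finset.mem_univ i))
  let e : ℕ × ℕ → ℕ := fun p => p.1 % n + p.2 * n
  have hinj : Set.InjOn e (↑(Finset.Icc 1 n ×ˢ Finset.range M) : Set (ℕ × ℕ)) := by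
    rintro ⟨i, j⟩ h ⟨i', j'⟩ h' hh
    simp only [Finset.coe_product, Set.mem_prod, Finset.mem_coe] at h h'
    simp only [e] at hh
    have h1 : i % n = i' % n := by
      have := congrArg (· % n) hh
      simpa using this
    have h2 : i = i' := eq_of_mem_mod n _ _ h.1 h'.1 h1
    rw [h1] at hh
    have h3 : j = j' := Nat.eq_of_mul_eq_mul_right hn (Nat.add_left_cancel hh)
    rw [h2, h3]
  let S := (Finset.Icc 1 n ×ˢ Finset.range M).image e
  have hS : ∀ i, nu i ∈ S := by
    intro i
    refine Finset.mem_image.2 ⟨(redu n (nu i), nu i / n), ?_, ?_⟩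
    · rw [Finset.mem_product]
      exact ⟨redu_mem n _ hn, Finset.mem_range.2 (lt_of_le_of_lt (Nat.div_le_self _ _) (hle i))⟩
    · simp only [e]
      rw [redu_mod]
      exact Nat.mod_add_div' _ _
  have hprodS : ∏ v ∈ S, (multCnt nu v).factorial = ∏ i ∈ Finset.Icc 1 n,
      ∏ j ∈ Finset.range M, (multCnt nu (i % n + j * n)).factorial := by
    rw [Finset.prod_image hinj, Finset.prod_product]
  have hfib : ∀ be ∈ rearr nuc, ((rearr nu).filter fun b => redu n ∘ b = be).card *
      ∏ i ∈ Finset.Icc 1 n, ∏ j ∈ Finset.range M, (multCnt nu (i % n + j * n)).factorial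
      = ∏ i ∈ Finset.Icc 1 n, (multCnt nuc i).factorial := by
    intro be hbe
    rw [← hprodS, fiber_card nu be (redu n) (hrc be hbe) S (Finset.Icc 1 n) hS
      (fun i => redu_mem n _ hn)]
    simp only [hmc]
  have hsum : ∀ i ∈ Finset.Icc 1 n,
      multCnt nuc i = ∑ j ∈ Finset.range M, multCnt nu (i % n + j * n) := by
    intro i hi
    rw [← hmc]
    unfold multCnt
    rw [Finset.card_eq_sum_card_fiberwise (f := fun x => nu x / n) (t := Finset.range M)]
    · refine Finset.sum_congr rfl fun j _ => ?_
      rw [Finset.filter_filter]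
      refine congrArg Finset.card (Finset.filter_congr ?_)
      intro x _
      simp only [Function.comp]
      constructor
      · rintro ⟨h1, h2⟩
        rw [← h1, redu_mod, ← h2]
        exact (Nat.mod_add_div' _ _).symm
      · intro h
        refine ⟨eq_of_mem_mod n _ _ (redu_mem n _ hn) hi ?_, ?_⟩
        · rw [redu_mod, h]; simp
        · rw [h, Nat.add_mul_div_right _ _ hn, Nat.div_eq_of_lt (Nat.mod_lt _ hn), zero_add]
    · intro x _
      simp only [Finset.coe_range, Set.mem_Iio]
      exact lt_of_le_of_lt (Nat.div_le_self _ _) (hle x)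
  set D : ℕ → ℕ := fun i => ∏ j ∈ Finset.range M, (multCnt nu (i % n + j * n)).factorial with hD
  have hDdvd : ∀ i ∈ Finset.Icc 1 n, D i ∣ (multCnt nuc i).factorial := by
    intro i hi
    rw [hsum i hi]
    exact Nat.prod_factorial_dvd_factorial_sum _ _
  have hDpos : 0 < ∏ i ∈ Finset.Icc 1 n, D i :=
    Finset.prod_pos fun i _ => Finset.prod_pos fun j _ => Nat.factorial_pos _
  have hC : ∀ be ∈ rearr nuc, ((rearr nu).filter fun b => redu n ∘ b = be).card
      = ∏ i ∈ Finset.Icc 1 n, ((multCnt nuc i).factorial / D i) := by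
    intro be hbe
    refine Nat.eq_of_mul_eq_mul_right hDpos ?_
    rw [hfib be hbe, ← Finset.prod_mul_distrib]
    exact Finset.prod_congr rfl fun i hi => (Nat.div_mul_cancel (hDdvd i hi)).symm
  rw [fusionN_eq, fusionN_eq, fset_card n k mu nu lam nuc _ s hs hC, mul_assoc]
  congr 1
  obtain ⟨m, rfl⟩ : ∃ m, n = m + 1 := ⟨n - 1, by omega⟩
  rw [Finset.prod_Icc_succ_top (by omega), mul_comm, Nat.add_sub_cancel]
  congr 1
  · simp [hD]
  · refine Finset.prod_congr rfl fun i hi => ?_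
    rw [Finset.mem_Icc] at hi
    simp only [hD]
    rw [Nat.mod_eq_of_lt (by omega : i < m + 1)]
end

section
/- Let n, k ≥ 1 and ζ = exp(2πi/n) ∈ ℂ. For all α, β ∈ A_{k,n} one has (1/n^k) Σ_{λ ∈ A_{k,n}} (|S_λ|/|S_α|) · m_λ(ζ^{−α_1},…,ζ^{−α_k}) · m_λ(ζ^{β_1},…,ζ^{β_k}) = 1 if α = β, and = 0 if α ≠ β. -/
open Finset Complex

/-- The evaluation `m_λ(x_1,…,x_k)` of the monomial symmetric polynomial at a point. -/
noncomputable def mEval {k : ℕ} (lam : Fin k → ℕ) (x : Fin k → ℂ) : ℂ :=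
  ∑ a ∈ rearr lam, ∏ i, x i ^ a i

/-- `|S_λ| = Π_j m_j(λ)!`, the order of the stabiliser of `λ`.  (The product over all
`j` is truncated at the largest part; all further factors are `0! = 1`.) -/
def stabCard {k : ℕ} (a : Fin k → ℕ) : ℕ :=
  ∏ j ∈ Finset.range (Finset.univ.sup a + 1), (multCnt a j).factorial

lemma stab_card_eq {k : ℕ} (a : Fin k → ℕ) :
    (univ.filter fun w : Equiv.Perm (Fin k) => a ∘ w = a).card = stabCard a := by
  rw [← Fintype.card_subtype, DomMulAct.stabilizer_card']
  unfold stabCard multCnt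
  simp only [Fintype.card_subtype]
  apply Finset.prod_subset
  · intro j hj
    obtain ⟨i, -, rfl⟩ := Finset.mem_image.1 hj
    exact Finset.mem_range.2 (Nat.lt_succ_of_le (Finset.le_sup (f := a) (Finset.mem_univ i)))
  · intro j _ hj
    rw [Finset.card_eq_zero.2, Nat.factorial_zero]
    rw [Finset.filter_eq_empty_iff]
    intro i _ h
    exact hj (Finset.mem_image.2 ⟨i, Finset.mem_univ i, h⟩)

lemma sum_perm_eq {k : ℕ} (a : Fin k → ℕ) (f : (Fin k → ℕ) → ℂ) :
    ∑ w : Equiv.Perm (Fin k), f (a ∘ w) = (stabCard a : ℂ) * ∑ b ∈ rearr a, f b := by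
  rw [Finset.sum_comp f (fun w : Equiv.Perm (Fin k) => a ∘ w), Finset.mul_sum]
  refine Finset.sum_congr rfl fun b hb => ?_
  obtain ⟨v, -, rfl⟩ := Finset.mem_image.1 hb
  rw [nsmul_eq_mul, ← stab_card_eq]
  congr 2
  refine Finset.card_bij' (fun w _ => w * v⁻¹) (fun w _ => w * v) ?_ ?_ ?_ ?_
  · intro w hw
    have h := (Finset.mem_filter.1 hw).2
    refine Finset.mem_filter.2 ⟨Finset.mem_univ _, ?_⟩
    funext i
    have := congrFun h (v⁻¹ i)
    simpa using this
  · intro w hw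
    have h := (Finset.mem_filter.1 hw).2
    refine Finset.mem_filter.2 ⟨Finset.mem_univ _, ?_⟩
    funext i
    exact congrFun h (v i)
  · intro w _; simp
  · intro w _; simp

lemma alcove_unique {n k : ℕ} {a b : Fin k → ℕ} (ha : a ∈ alcoveFinset n k)
    (hb : b ∈ alcoveFinset n k) (w : Equiv.Perm (Fin k)) (h : b = a ∘ w) : a = b := by
  have h1 : Antitone (a ∘ (1 : Equiv.Perm (Fin k))) := fun i j hij =>
    (Finset.mem_filter.1 ha).2 i j hij
  have h2 : Antitone (a ∘ w) := by
    rw [← h]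
    exact fun i j hij => (Finset.mem_filter.1 hb).2 i j hij
  have := Tuple.unique_antitone h1 h2
  rw [h, ← this]; rfl

lemma sum_alcove {n k : ℕ} (F : (Fin k → ℕ) → ℂ) :
    ∑ lam ∈ alcoveFinset n k, ∑ b ∈ rearr lam, F b =
      ∑ b ∈ Fintype.piFinset (fun _ : Fin k => Finset.Icc 1 n), F b := by
  rw [← Finset.sum_biUnion]
  · refine Finset.sum_congr ?_ fun _ _ => rfl
    ext b
    rw [Finset.mem_biUnion]
    constructor
    · rintro ⟨a, ha, hb⟩
      obtain ⟨v, -, rfl⟩ := Finset.mem_image.1 hb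
      have := (Finset.mem_filter.1 ha).1
      rw [Fintype.mem_piFinset] at this ⊢
      exact fun i => this (v i)
    · intro hb
      rw [Fintype.mem_piFinset] at hb
      let s : Equiv.Perm (Fin k) := Tuple.sort b
      let v : Equiv.Perm (Fin k) := s * Fin.revPerm
      refine ⟨b ∘ v, Finset.mem_filter.2 ⟨?_, ?_⟩, ?_⟩
      · rw [Fintype.mem_piFinset]; exact fun i => hb (v i)
      · intro i j hij
        exact Tuple.monotone_sort b (Fin.rev_le_rev.2 hij)
      · refine Finset.mem_image.2 ⟨v⁻¹, Finset.mem_univ _, ?_⟩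
        funext i; simp
  · intro a ha b hb hab
    rw [Function.onFun, Finset.disjoint_left]
    intro c hca hcb
    obtain ⟨v, -, rfl⟩ := Finset.mem_image.1 hca
    obtain ⟨u, -, hu⟩ := Finset.mem_image.1 hcb
    apply hab
    refine alcove_unique (n := n) ha hb (v * u⁻¹) ?_
    funext i
    have := congrFun hu (u⁻¹ i)
    simpa using this

lemma sum_root {n : ℕ} (hn : 1 ≤ n) {z : ℂ} (hz : IsPrimitiveRoot z n) {p q : ℕ}
    (hp : p ∈ Finset.Icc 1 n) (hq : q ∈ Finset.Icc 1 n) :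
    ∑ c ∈ Finset.Icc 1 n, (z ^ (-(p : ℤ)) * z ^ q) ^ c = if p = q then (n : ℂ) else 0 := by
  have hz0 : z ≠ 0 := hz.ne_zero (by omega)
  have e : z ^ (-(p : ℤ)) * z ^ q = z ^ ((q : ℤ) - p) := by
    rw [← zpow_natCast z q, ← zpow_add₀ hz0]; congr 1; ring
  rw [e]
  rw [Finset.mem_Icc] at hp hq
  split_ifs with h
  · subst h; simp
  · have h1 : z ^ ((q : ℤ) - p) ≠ 1 := by
      rw [Ne, hz.zpow_eq_one_iff_dvd]
      intro hd
      have := Int.eq_zero_of_abs_lt_dvd hd (by rw [abs_lt]; omega)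
      omega
    have h2 : (z ^ ((q : ℤ) - p)) ^ n = 1 := by
      rw [← zpow_natCast, ← zpow_mul, mul_comm, zpow_mul, zpow_natCast, hz.pow_eq_one, one_zpow]
    generalize z ^ ((q : ℤ) - p) = t at *
    have h3 : ∑ c ∈ Finset.range n, t ^ c = 0 := by
      rw [geom_sum_eq h1, h2]; simp
    rw [← Finset.Ico_add_one_right_eq_Icc, Finset.sum_Ico_eq_sum_range]
    simp only [pow_add, ← Finset.mul_sum, Nat.add_sub_cancel, h3, mul_zero]

lemma main_sum {n k : ℕ} (x y : Fin k → ℂ) :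
    ∑ lam ∈ alcoveFinset n k, (stabCard lam : ℂ) * mEval lam x * mEval lam y =
      ∑ w : Equiv.Perm (Fin k), ∏ i, ∑ c ∈ Finset.Icc 1 n, (x (w i) * y i) ^ c := by
  have key : ∀ lam : Fin k → ℕ, (stabCard lam : ℂ) * mEval lam x * mEval lam y =
      ∑ b ∈ rearr lam, ∑ w : Equiv.Perm (Fin k), ∏ i, (x (w i) * y i) ^ b i := by
    intro lam
    unfold mEval
    rw [← sum_perm_eq lam (fun a => ∏ i, x i ^ a i), Finset.mul_sum]
    refine Finset.sum_congr rfl fun b hb => ?_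
    obtain ⟨v, -, rfl⟩ := Finset.mem_image.1 hb
    rw [Finset.sum_mul]
    refine Fintype.sum_equiv ((Equiv.mulLeft v⁻¹).trans (Equiv.inv _)) _ _ fun w => ?_
    simp only [mul_pow, Finset.prod_mul_distrib]
    congr 1
    refine Fintype.prod_equiv (v⁻¹ * w) _ _ fun i => ?_
    simp
  rw [Finset.sum_congr rfl fun lam _ => key lam, sum_alcove, Finset.sum_comm]
  refine Finset.sum_congr rfl fun w _ => ?_
  rw [Finset.prod_univ_sum]

/-- with `ζ = exp(2πi/n)`, for all `α, β ∈ A_{k,n}` one has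
`(1/n^k) Σ_{λ ∈ A_{k,n}} (|S_λ|/|S_α|) m_λ(ζ^{−α}) m_λ(ζ^{β}) = δ_{αβ}`. -/
theorem stmt_16 (n k : ℕ) (hn : 1 ≤ n) (hk : 1 ≤ k) (al be : Fin k → ℕ)
    (hal : al ∈ alcoveFinset n k) (hbe : be ∈ alcoveFinset n k) :
    (1 / (n : ℂ) ^ k) *
        ∑ lam ∈ alcoveFinset n k,
          ((stabCard lam : ℂ) / (stabCard al : ℂ)) *
            mEval lam (fun i => Complex.exp (2 * Real.pi * Complex.I / n) ^ (-(al i : ℤ))) *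
            mEval lam (fun i => Complex.exp (2 * Real.pi * Complex.I / n) ^ (be i : ℕ)) =
      if al = be then 1 else 0 := by
  have hz := Complex.isPrimitiveRoot_exp n (by omega)
  generalize Complex.exp (2 * Real.pi * Complex.I / n) = z at *
  have hn0 : (n : ℂ) ≠ 0 := by exact_mod_cast (by omega : n ≠ 0)
  have hs0 : (stabCard al : ℂ) ≠ 0 := by
    have : stabCard al ≠ 0 := Finset.prod_ne_zero_iff.2 fun j _ => Nat.factorial_ne_zero _
    exact_mod_cast this
  have h1 : ∀ (x y : Fin k → ℂ), ∑ lam ∈ alcoveFinset n k,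
      ((stabCard lam : ℂ) / (stabCard al : ℂ)) * mEval lam x * mEval lam y =
      (∑ lam ∈ alcoveFinset n k, (stabCard lam : ℂ) * mEval lam x * mEval lam y) /
        (stabCard al : ℂ) := by
    intro x y
    rw [Finset.sum_div]
    exact Finset.sum_congr rfl fun _ _ => by ring
  have ha := Fintype.mem_piFinset.1 (Finset.mem_filter.1 hal).1
  have hb := Fintype.mem_piFinset.1 (Finset.mem_filter.1 hbe).1
  have h2 : ∀ w : Equiv.Perm (Fin k),
      ∏ i, ∑ c ∈ Finset.Icc 1 n, (z ^ (-(al (w i) : ℤ)) * z ^ (be i)) ^ c =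
        if al ∘ w = be then (n : ℂ) ^ k else 0 := by
    intro w
    rw [Finset.prod_congr rfl fun i _ => sum_root hn hz (ha (w i)) (hb i)]
    split_ifs with h
    · have h' : ∀ i, al (w i) = be i := fun i => congrFun h i
      simp [h']
    · obtain ⟨i, hi⟩ := Function.ne_iff.1 h
      exact Finset.prod_eq_zero (Finset.mem_univ i) (if_neg hi)
  rw [h1, main_sum, Finset.sum_congr rfl fun w _ => h2 w, ← Finset.sum_filter,
    Finset.sum_const, nsmul_eq_mul]
  split_ifs with h
  · subst h
    rw [stab_card_eq]
    field_simp
  · rw [Finset.card_eq_zero.2]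
    · simp
    · rw [Finset.filter_eq_empty_iff]
      intro w _ hw
      exact h (alcove_unique hal hbe w hw.symm)
end

section
/- Let n, k ≥ 1 and write ζ^q = exp(2πiq/n) for rational q. Define matrices indexed by A_{k,n}: 𝒯_{λμ} = δ_{λμ} · ζ^{−kn(n−1)/24} · Π_{i=1}^k ζ^{λ_i(n−λ_i)/2}, and 𝒞_{λμ} = δ_{μ,λ*}, where for m = m_n(λ) one sets λ* = (n,…,n (m times), n−λ_k, n−λ_{k−1}, …, n−λ_{m+1}) ∈ A_{k,n}. Then (𝒮𝒯)^3 = 𝒮² = 𝒞, 𝒞² = Id, 𝒮 is unitary (𝒮^{−1} equals the conjugate transpose of 𝒮), the entrywise complex conjugate transpose 𝒮^* satisfies 𝒮^* = 𝒞𝒮 = 𝒮𝒞, and 𝒞𝒯𝒞 = 𝒯. -/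
open Finset Complex Matrix

/-- The modular `𝒮`-matrix `𝒮_{λα} = sqrt(|S_λ|/|S_α|) · m_λ(ζ^α) · n^{−k/2}`,
with rows and columns indexed by the alcove `A_{k,n}` and `ζ = exp(2πi/n)`. -/
noncomputable def Smat (n k : ℕ) :
    Matrix {a : Fin k → ℕ // a ∈ alcoveFinset n k} {a : Fin k → ℕ // a ∈ alcoveFinset n k} ℂ :=
  Matrix.of fun l a =>
    ((Real.sqrt ((stabCard l.1 : ℝ) / (stabCard a.1 : ℝ)) : ℝ) : ℂ) *
      mEval l.1 (fun i => Complex.exp (2 * Real.pi * Complex.I / n) ^ (a.1 i : ℕ)) *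
      (((Real.sqrt ((n : ℝ) ^ k) : ℝ) : ℂ))⁻¹

/-- `ζ^q := exp(2πiq/n)` for rational `q`. -/
noncomputable def zetaPow (n : ℕ) (q : ℚ) : ℂ :=
  Complex.exp (2 * Real.pi * Complex.I * (q : ℂ) / n)

/-- The matrix `𝒯_{λμ} = δ_{λμ} ζ^{−kn(n−1)/24} Π_{i=1}^k ζ^{λ_i(n−λ_i)/2}`. -/
noncomputable def Tmat (n k : ℕ) :
    Matrix {a : Fin k → ℕ // a ∈ alcoveFinset n k} {a : Fin k → ℕ // a ∈ alcoveFinset n k} ℂ :=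
  Matrix.of fun l m =>
    if l = m then
      zetaPow n (-((k : ℚ) * n * (n - 1)) / 24) *
        ∏ i : Fin k, zetaPow n ((l.1 i : ℚ) * ((n : ℚ) - (l.1 i : ℚ)) / 2)
    else 0

/-- `λ* = τ^{m_n(λ)}(n−λ_k, …, n−λ_2, n−λ_1)`: with `m = m_n(λ)`, the tuple
`(n,…,n (m times), n−λ_k, n−λ_{k−1}, …, n−λ_{m+1})`. -/
def starTuple (n k : ℕ) (a : Fin k → ℕ) : Fin k → ℕ := fun i =>
  if h : (i : ℕ) < multCnt a n then n
  else n - a ⟨k + multCnt a n - 1 - (i : ℕ), by have := i.isLt; omega⟩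

/-- The charge-conjugation matrix `𝒞_{λμ} = δ_{μ,λ*}`. -/
noncomputable def Cmat (n k : ℕ) :
    Matrix {a : Fin k → ℕ // a ∈ alcoveFinset n k} {a : Fin k → ℕ // a ∈ alcoveFinset n k} ℂ :=
  Matrix.of fun l m => if m.1 = starTuple n k l.1 then 1 else 0


section Combi

variable {n k : ℕ}

lemma stab_eq (a : Fin k → ℕ) :
    stabCard a = (univ.filter fun w : Equiv.Perm (Fin k) => a ∘ w = a).card := by
  rw [← Fintype.card_subtype, DomMulAct.stabilizer_card']
  unfold stabCard
  symm
  have : ∀ j, multCnt a j = Fintype.card {i // a i = j} := by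
    intro j; rw [Fintype.card_subtype]; rfl
  simp_rw [this]
  apply Finset.prod_subset
  · intro x hx
    simp only [Finset.mem_image, Finset.mem_univ, true_and] at hx
    obtain ⟨i, rfl⟩ := hx
    have := Finset.le_sup (f := a) (Finset.mem_univ i)
    simp only [Finset.mem_range]; omega
  · intro x _ hx
    have : IsEmpty {i // a i = x} := ⟨fun i => hx (by
      simp only [Finset.mem_image, Finset.mem_univ, true_and]; exact ⟨i.1, i.2⟩)⟩
    simp [Fintype.card_eq_zero]

lemma stab_pos (a : Fin k → ℕ) : 0 < stabCard a :=
  Finset.prod_pos fun _ _ => Nat.factorial_pos _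

lemma count_comp (a b : Fin k → ℕ) (s : Equiv.Perm (Fin k)) :
    (univ.filter fun w : Equiv.Perm (Fin k) => a ∘ w = b ∘ s).card
      = (univ.filter fun w : Equiv.Perm (Fin k) => a ∘ w = b).card := by
  apply Finset.card_bij (fun w _ => w * s⁻¹)
  · intro w hw
    simp only [Finset.mem_filter, Finset.mem_univ, true_and] at hw ⊢
    funext i
    have := congrFun hw (s⁻¹ i)
    simpa using this
  · intro w _ w' _ h
    simpa using h
  · intro w hw
    refine ⟨w * s, ?_, by simp⟩
    simp only [Finset.mem_filter, Finset.mem_univ, true_and] at hw ⊢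
    funext i
    have := congrFun hw (s i)
    simpa using this

lemma mem_alc (a : Fin k → ℕ) :
    a ∈ alcoveFinset n k ↔ (∀ i, 1 ≤ a i ∧ a i ≤ n) ∧ Antitone a := by
  unfold alcoveFinset
  simp only [Finset.mem_filter, Fintype.mem_piFinset, Finset.mem_Icc]
  rfl

lemma alc_eq {a b : Fin k → ℕ} (ha : Antitone a) (hb : Antitone b) (w : Equiv.Perm (Fin k))
    (h : a ∘ w = b) : a = b := by
  have := Tuple.unique_antitone (f := a) (σ := 1) (τ := w) (by simpa using ha) (by rw [h]; exact hb)
  rw [← h, ← this]; rfl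

lemma count_alc (a b : Fin k → ℕ) (ha : Antitone a) (hb : Antitone b) :
    (univ.filter fun w : Equiv.Perm (Fin k) => a ∘ w = b).card
      = if a = b then stabCard a else 0 := by
  split_ifs with h
  · subst h; rw [stab_eq]
  · rw [Finset.card_eq_zero, Finset.filter_eq_empty_iff]
    intro w _ hw
    exact h (alc_eq ha hb w hw)

lemma exists_sort (a : Fin k → ℕ) : ∃ s : Equiv.Perm (Fin k), Antitone (a ∘ s) := by
  refine ⟨Fin.revPerm.trans (Tuple.sort a), ?_⟩
  intro i j hij
  have := Tuple.monotone_sort a (a := Fin.rev j) (b := Fin.rev i) (by simpa using hij)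
  simpa using this

/-- each tuple is covered with total weight one -/
lemma weight_one (a : Fin k → ℕ) (ha : ∀ i, 1 ≤ a i ∧ a i ≤ n) :
    ∑ l : {a : Fin k → ℕ // a ∈ alcoveFinset n k}, ∑ w : Equiv.Perm (Fin k),
      (if l.1 ∘ w = a then (stabCard l.1 : ℂ)⁻¹ else 0) = 1 := by
  obtain ⟨s, hs⟩ := exists_sort a
  have hb : a ∘ s ∈ alcoveFinset n k := (mem_alc _).2 ⟨fun i => ha _, hs⟩
  rw [Fintype.sum_eq_single ⟨a ∘ s, hb⟩]
  · rw [← Finset.sum_filter, Finset.sum_const]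
    have : (univ.filter fun w : Equiv.Perm (Fin k) => (a ∘ s) ∘ w = a).card = stabCard (a ∘ s) := by
      rw [← count_comp _ a s, count_alc _ _ hs hs, if_pos rfl]
    rw [this, nsmul_eq_mul, mul_inv_cancel₀]
    exact_mod_cast (stab_pos _).ne'
  · intro l hl
    apply Finset.sum_eq_zero
    intro w _
    rw [if_neg]
    intro h
    apply hl
    apply Subtype.ext
    apply alc_eq ((mem_alc _).1 l.2).2 hs (w * s)
    rw [← h]; rfl

/-- cast to `ZMod n`. -/
def zc (n : ℕ) {k : ℕ} (a : Fin k → ℕ) : Fin k → ZMod n := fun i => (a i : ZMod n)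

/-- lift from `ZMod n` to `1..n`. -/
def zl (n : ℕ) (x : ZMod n) : ℕ := if x = 0 then n else x.val

lemma zl_mem [NeZero n] (x : ZMod n) : 1 ≤ zl n x ∧ zl n x ≤ n := by
  unfold zl
  split_ifs with h
  · exact ⟨Nat.one_le_iff_ne_zero.2 (NeZero.ne n), le_rfl⟩
  · exact ⟨Nat.one_le_iff_ne_zero.2 (by simpa using h), (ZMod.val_lt x).le⟩

lemma cast_zl [NeZero n] (x : ZMod n) : ((zl n x : ℕ) : ZMod n) = x := by
  unfold zl
  split_ifs with h
  · simp [h]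
  · simp

lemma zl_cast [NeZero n] (a : ℕ) (h1 : 1 ≤ a) (h2 : a ≤ n) : zl n (a : ZMod n) = a := by
  unfold zl
  rcases h2.lt_or_eq with h | h
  · rw [if_neg, ZMod.val_cast_of_lt h]
    rw [ZMod.natCast_eq_zero_iff]
    intro h'
    have := Nat.le_of_dvd (by omega) h'
    omega
  · subst h; simp

lemma zc_inj [NeZero n] {a b : Fin k → ℕ} (ha : ∀ i, 1 ≤ a i ∧ a i ≤ n)
    (hb : ∀ i, 1 ≤ b i ∧ b i ≤ n) (h : zc n a = zc n b) : a = b := by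
  funext i
  have := congrArg (zl n) (congrFun h i)
  simpa [zc, zl_cast _ (ha i).1 (ha i).2, zl_cast _ (hb i).1 (hb i).2] using this

lemma sum_alc [NeZero n] (F : (Fin k → ZMod n) → ℂ)
    (hF : ∀ a (w : Equiv.Perm (Fin k)), F (a ∘ w) = F a) :
    ∑ l : {a : Fin k → ℕ // a ∈ alcoveFinset n k}, (stabCard l.1 : ℂ)⁻¹ * F (zc n l.1)
      = (k.factorial : ℂ)⁻¹ * ∑ a, F a := by
  have h1 : ∀ a : Fin k → ZMod n, F a = ∑ l : {a : Fin k → ℕ // a ∈ alcoveFinset n k},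
      ∑ w : Equiv.Perm (Fin k), (if zc n l.1 ∘ w = a then (stabCard l.1 : ℂ)⁻¹ * F (zc n l.1) else 0) := by
    intro a
    have := weight_one (n := n) (fun i => zl n (a i)) (fun i => zl_mem _)
    calc F a = 1 * F a := by ring
      _ = _ := by
        rw [← this, Finset.sum_mul]
        refine Finset.sum_congr rfl fun l _ => ?_
        rw [Finset.sum_mul]
        refine Finset.sum_congr rfl fun w _ => ?_
        have hiff : (l.1 ∘ w = fun i => zl n (a i)) ↔ zc n l.1 ∘ w = a := by
          constructor
          · intro h
            funext i
            have := congrFun h i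
            simp only [Function.comp, zc] at this ⊢
            rw [this, cast_zl]
          · intro h
            funext i
            rw [← h]
            have := ((mem_alc _).1 l.2).1 (w i)
            simp only [Function.comp, zc]
            rw [zl_cast _ this.1 this.2]
        by_cases h : zc n l.1 ∘ w = a
        · rw [if_pos h, if_pos (hiff.2 h), ← h, hF]
        · rw [if_neg h, if_neg (fun h' => h (hiff.1 h')), zero_mul]
  have h2 : ∑ a, F a = (k.factorial : ℂ) *
      ∑ l : {a : Fin k → ℕ // a ∈ alcoveFinset n k}, (stabCard l.1 : ℂ)⁻¹ * F (zc n l.1) := by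
    rw [Finset.sum_congr rfl fun a _ => h1 a, Finset.sum_comm, Finset.mul_sum]
    refine Finset.sum_congr rfl fun l _ => ?_
    rw [Finset.sum_comm]
    simp [Fintype.card_perm]
  rw [h2, ← mul_assoc, inv_mul_cancel₀ (by exact_mod_cast k.factorial_ne_zero), one_mul]

/-- symmetrised kernel -/
noncomputable def PP (M : Matrix (ZMod n) (ZMod n) ℂ) (a b : Fin k → ZMod n) : ℂ :=
  ∑ w : Equiv.Perm (Fin k), ∏ i, M (a (w i)) (b i)

lemma PP_left (M : Matrix (ZMod n) (ZMod n) ℂ) (a b : Fin k → ZMod n) (s : Equiv.Perm (Fin k)) :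
    PP M (a ∘ s) b = PP M a b := by
  unfold PP
  exact Fintype.sum_equiv (Equiv.mulLeft s) _ _ (fun w => by simp)

lemma PP_right (M : Matrix (ZMod n) (ZMod n) ℂ) (a b : Fin k → ZMod n) (s : Equiv.Perm (Fin k)) :
    PP M a (b ∘ s) = PP M a b := by
  unfold PP
  refine Fintype.sum_equiv (Equiv.mulRight s⁻¹) _ _ (fun w => ?_)
  exact Fintype.prod_equiv s _ _ (fun i => by simp)

lemma PP_mul [NeZero n] (M N : Matrix (ZMod n) (ZMod n) ℂ) (a b : Fin k → ZMod n) :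
    ∑ c, PP M a c * PP N c b = k.factorial * PP (M * N) a b := by
  have h : ∀ w : Equiv.Perm (Fin k), ∑ c, PP M a c * ∏ i, N (c (w i)) (b i) = PP (M * N) a b := by
    intro w
    have e1 : ∀ c : Fin k → ZMod n, PP M a c * ∏ i, N (c (w i)) (b i)
        = PP M a (c ∘ w) * ∏ i, N ((c ∘ w) i) (b i) := by
      intro c; rw [PP_right]; rfl
    rw [Finset.sum_congr rfl fun c _ => e1 c]
    have e2 := Fintype.sum_equiv (Equiv.arrowCongr w⁻¹ (Equiv.refl (ZMod n)))
      (fun c : Fin k → ZMod n => PP M a (c ∘ w) * ∏ i, N ((c ∘ w) i) (b i))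
      (fun c => PP M a c * ∏ i, N (c i) (b i)) (fun c => rfl)
    rw [e2]
    unfold PP
    simp_rw [Finset.sum_mul]
    rw [Finset.sum_comm]
    refine Finset.sum_congr rfl fun v _ => ?_
    simp_rw [← Finset.prod_mul_distrib, Matrix.mul_apply]
    rw [Finset.prod_univ_sum, Fintype.piFinset_univ]
  calc ∑ c, PP M a c * PP N c b
      = ∑ w : Equiv.Perm (Fin k), ∑ c, PP M a c * ∏ i, N (c (w i)) (b i) := by
        rw [Finset.sum_comm]
        refine Finset.sum_congr rfl fun c _ => ?_
        rw [← Finset.mul_sum]; rfl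
    _ = _ := by
        rw [Finset.sum_congr rfl fun w _ => h w]
        simp [Fintype.card_perm]

/-- inverse square root of the stabiliser order -/
noncomputable def rs (a : Fin k → ℕ) : ℂ := ((Real.sqrt (stabCard a : ℝ) : ℝ) : ℂ)⁻¹

lemma rs_sq (a : Fin k → ℕ) : rs a * rs a = (stabCard a : ℂ)⁻¹ := by
  unfold rs
  rw [← mul_inv, ← Complex.ofReal_mul, Real.mul_self_sqrt (by positivity)]
  simp

/-- the symmetric power of a matrix -/
noncomputable def Sy (k : ℕ) (M : Matrix (ZMod n) (ZMod n) ℂ) :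
    Matrix {a : Fin k → ℕ // a ∈ alcoveFinset n k} {a : Fin k → ℕ // a ∈ alcoveFinset n k} ℂ :=
  Matrix.of fun l m => rs l.1 * rs m.1 * PP M (zc n l.1) (zc n m.1)

lemma Sy_mul [NeZero n] (M N : Matrix (ZMod n) (ZMod n) ℂ) :
    Sy k M * Sy k N = Sy k (M * N) := by
  ext l m
  rw [Matrix.mul_apply]
  have : ∀ c : {a : Fin k → ℕ // a ∈ alcoveFinset n k}, Sy k M l c * Sy k N c m =
      rs l.1 * rs m.1 * ((stabCard c.1 : ℂ)⁻¹ * (PP M (zc n l.1) (zc n c.1) * PP N (zc n c.1) (zc n m.1))) := by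
    intro c
    simp only [Sy, Matrix.of_apply]
    rw [← rs_sq]; ring
  rw [Finset.sum_congr rfl fun c _ => this c, ← Finset.mul_sum,
    sum_alc (fun c => PP M (zc n l.1) c * PP N c (zc n m.1)), PP_mul, ← mul_assoc (_⁻¹),
    inv_mul_cancel₀ (by exact_mod_cast k.factorial_ne_zero), one_mul]
  · rfl
  · intro a w
    rw [PP_left, PP_right]

lemma Sy_conj (M : Matrix (ZMod n) (ZMod n) ℂ) : (Sy k M)ᴴ = Sy k Mᴴ := by
  have hrs : ∀ a : Fin k → ℕ, star (rs a) = rs a := by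
    intro a; unfold rs
    rw [← Complex.ofReal_inv]; exact Complex.conj_ofReal _
  ext l m
  simp only [Sy, Matrix.conjTranspose_apply, Matrix.of_apply, star_mul', hrs]
  rw [mul_comm (rs m.1)]
  congr 1
  unfold PP
  rw [star_sum]
  refine Fintype.sum_equiv (Equiv.inv _) _ _ (fun w => ?_)
  rw [star_prod]
  refine Fintype.prod_equiv w _ _ (fun i => by simp)

/-- diagonal-type matrices -/
lemma Sy_perm [NeZero n] (f : ZMod n → ZMod n) (d : ZMod n → ℂ)
    (l m : {a : Fin k → ℕ // a ∈ alcoveFinset n k}) (b : Fin k → ℕ) (s : Equiv.Perm (Fin k))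
    (hb : b ∈ alcoveFinset n k) (hbs : ∀ i, f (l.1 (s i)) = (b i : ZMod n))
    (hst : stabCard b = stabCard l.1) :
    Sy k (Matrix.of fun x y => if f x = y then d x else 0) l m
      = if b = m.1 then ∏ i, d (l.1 i) else 0 := by
  have hm := (mem_alc _).1 m.2
  have hb' := (mem_alc _).1 hb
  have key : PP (Matrix.of fun x y => if f x = y then d x else 0) (zc n l.1) (zc n m.1)
      = if b = m.1 then (stabCard l.1 : ℂ) * ∏ i, d (l.1 i) else 0 := by
    rw [← PP_left _ _ _ s]
    unfold PP
    have h1 : ∀ w : Equiv.Perm (Fin k), ∏ i, (Matrix.of fun x y => if f x = y then d x else 0)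
        ((zc n l.1 ∘ s) (w i)) (zc n m.1 i) = if b ∘ w = m.1 then ∏ i, d (l.1 i) else 0 := by
      intro w
      have hiff : b ∘ w = m.1 ↔ ∀ i, f ((zc n l.1 ∘ s) (w i)) = zc n m.1 i := by
        constructor
        · intro h i
          rw [← h]
          exact hbs (w i)
        · intro h
          apply zc_inj (n := n) (fun i => hb'.1 _) hm.1
          funext i
          rw [← h i]
          exact (hbs (w i)).symm
      split_ifs with h
      · rw [hiff] at h
        simp only [Matrix.of_apply, h, if_true]
        exact Fintype.prod_equiv (s * w) _ _ (fun i => rfl)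
      · rw [hiff] at h
        push Not at h
        obtain ⟨i, hi⟩ := h
        apply Finset.prod_eq_zero (Finset.mem_univ i)
        simp only [Matrix.of_apply, if_neg hi]
    rw [Finset.sum_congr rfl fun w _ => h1 w, ← Finset.sum_filter, Finset.sum_const,
      count_alc _ _ hb'.2 hm.2]
    split_ifs with h
    · rw [nsmul_eq_mul, hst]
    · simp
  simp only [Sy, Matrix.of_apply] at key ⊢
  rw [key]
  split_ifs with h
  · rw [← h]
    have : rs b = rs l.1 := by unfold rs; rw [hst]
    rw [this, rs_sq, ← mul_assoc, inv_mul_cancel₀, one_mul]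
    exact_mod_cast (stab_pos _).ne'
  · simp

lemma Sy_diag [NeZero n] (d : ZMod n → ℂ) (l m : {a : Fin k → ℕ // a ∈ alcoveFinset n k}) :
    Sy k (Matrix.diagonal d) l m = if l = m then ∏ i, d (l.1 i) else 0 := by
  have := Sy_perm id d l m l.1 1 l.2 (fun i => rfl) rfl
  simp only [Subtype.ext_iff, id] at this ⊢
  rw [← this]
  rfl

lemma Sy_one [NeZero n] : Sy k (1 : Matrix (ZMod n) (ZMod n) ℂ) = 1 := by
  ext l m
  rw [← Matrix.diagonal_one, Sy_diag, Matrix.one_apply]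
  simp

end Combi

section Ident

variable {n k : ℕ}

lemma lt_mult (a : Fin k → ℕ) (ha : a ∈ alcoveFinset n k) (i : Fin k) :
    (i : ℕ) < multCnt a n ↔ a i = n := by
  have h := (mem_alc _).1 ha
  have := Tuple.lt_card_ge_iff_apply_ge_of_antitone (j := i) (f := a) (a := n) h.2
  have e : multCnt a n = (univ.filter fun i => n ≤ a i).card := by
    unfold multCnt
    congr 1
    ext j
    have := (h.1 j).2
    simp only [Finset.mem_filter, Finset.mem_univ, true_and]
    omega
  rw [e]
  have h2 := (h.1 i).2
  constructor
  · intro h3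
    have := this.1 (by simpa using h3)
    omega
  · intro h3
    have := this.2 (by omega)
    simpa using this

/-- underlying function of the permutation -/
def stF (k m : ℕ) (i : Fin k) : Fin k :=
  if h : (i : ℕ) < m then i else ⟨k + m - 1 - (i : ℕ), by have := i.isLt; omega⟩

lemma stF_inv (k m : ℕ) : Function.Involutive (stF k m) := by
  intro i
  have := i.isLt
  unfold stF
  by_cases h : (i : ℕ) < m
  · simp [h]
  · have h2 : ¬ (k + m - 1 - (i : ℕ) < m) := by omega
    simp only [h, dif_neg, not_false_eq_true, h2]
    apply Fin.ext
    simp only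
    omega

lemma star_eq (a : Fin k → ℕ) (ha : a ∈ alcoveFinset n k) (i : Fin k) :
    starTuple n k a i = if a i = n then n else n - a (stF k (multCnt a n) i) := by
  unfold starTuple stF
  by_cases h : (i : ℕ) < multCnt a n
  · simp [h, (lt_mult a ha i).1 h]
  · have : a i ≠ n := fun h' => h ((lt_mult a ha i).2 h')
    simp [h, this]

lemma stF_iff (a : Fin k → ℕ) (ha : a ∈ alcoveFinset n k) (i : Fin k) :
    a (stF k (multCnt a n) i) = n ↔ a i = n := by
  rw [← lt_mult a ha, ← lt_mult a ha]
  have := i.isLt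
  unfold stF
  split_ifs with h
  · simp
  · simp only
    omega

lemma star_mem (a : Fin k → ℕ) (ha : a ∈ alcoveFinset n k) :
    starTuple n k a ∈ alcoveFinset n k := by
  have h := (mem_alc _).1 ha
  rw [mem_alc]
  constructor
  · intro i
    rw [star_eq a ha]
    have h0 := h.1 i
    have h1 := h.1 (stF k (multCnt a n) i)
    have h2 := stF_iff a ha i
    split_ifs with h3
    · omega
    · have : a (stF k (multCnt a n) i) ≠ n := fun h' => h3 (h2.1 h')
      omega
  · intro i j hij
    rw [star_eq a ha, star_eq a ha]
    by_cases hi : a i = n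
    · rw [if_pos hi]; split_ifs <;> omega
    · have hj : ¬ a j = n := by
        have := h.2 hij
        have := (h.1 i).2
        omega
      rw [if_neg hi, if_neg hj]
      have : a (stF k (multCnt a n) i) ≤ a (stF k (multCnt a n) j) := by
        apply h.2
        rw [← lt_mult a ha] at hi hj
        have h5 : (i : ℕ) ≤ j := hij
        simp only [stF, hi, hj, dif_neg, not_false_eq_true, Fin.le_def]
        omega
      omega

lemma starT_neg (a : Fin k → ℕ) (ha : a ∈ alcoveFinset n k) (i : Fin k) :
    -(a (stF k (multCnt a n) i) : ZMod n) = (starTuple n k a i : ZMod n) := by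
  have h := (mem_alc _).1 ha
  rw [star_eq a ha]
  split_ifs with h3
  · rw [(stF_iff a ha i).2 h3]; simp
  · rw [Nat.cast_sub (h.1 _).2]; simp

lemma star_stab [NeZero n] (a : Fin k → ℕ) (ha : a ∈ alcoveFinset n k) :
    stabCard (starTuple n k a) = stabCard a := by
  have h := (mem_alc _).1 ha
  have hb := (mem_alc _).1 (star_mem a ha)
  rw [stab_eq, stab_eq]
  set s : Equiv.Perm (Fin k) := (stF_inv k (multCnt a n)).toPerm with hs
  have hsn : ∀ i, -(a (s i) : ZMod n) = (starTuple n k a i : ZMod n) := starT_neg a ha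
  have key : ∀ w : Equiv.Perm (Fin k), starTuple n k a ∘ w = starTuple n k a ↔ a ∘ (s * w * s⁻¹) = a := by
    intro w
    constructor
    · intro h1
      apply zc_inj (n := n) (fun i => h.1 _) h.1
      funext i
      have := congrFun h1 (s⁻¹ i)
      have := congrArg (Nat.cast : ℕ → ZMod n) this
      rw [Function.comp, ← hsn, ← hsn, neg_inj] at this
      simpa [zc] using this
    · intro h1
      apply zc_inj (n := n) (fun i => hb.1 _) hb.1
      funext i
      have := congrFun h1 (s i)
      simp only [zc]
      rw [← hsn, ← hsn, neg_inj]
      congr 1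
      simpa using this
  refine Finset.card_bij (fun w _ => s * w * s⁻¹) ?_ ?_ ?_
  · intro w hw
    simp only [Finset.mem_filter, Finset.mem_univ, true_and] at hw ⊢
    exact (key w).1 hw
  · intro w _ w' _ hh
    simpa using hh
  · intro w hw
    simp only [Finset.mem_filter, Finset.mem_univ, true_and] at hw ⊢
    refine ⟨s⁻¹ * w * s, (key _).2 ?_, by group⟩
    have : s * (s⁻¹ * w * s) * s⁻¹ = w := by group
    rw [this]; exact hw

/-- rank one C -/
noncomputable def C1 (n : ℕ) : Matrix (ZMod n) (ZMod n) ℂ :=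
  Matrix.of fun x y => if -x = y then 1 else 0

/-- rank one S -/
noncomputable def S1 (n : ℕ) [NeZero n] : Matrix (ZMod n) (ZMod n) ℂ :=
  Matrix.of fun x y => ZMod.stdAddChar (x * y) * ((Real.sqrt (n : ℝ) : ℝ) : ℂ)⁻¹

/-- rank one quadratic character -/
noncomputable def q1 (n : ℕ) (x : ZMod n) : ℂ :=
  zetaPow n ((x.val : ℚ) * ((n : ℚ) - (x.val : ℚ)) / 2)

/-- rank one normalisation -/
noncomputable def c1 (n : ℕ) : ℂ := zetaPow n (-((n : ℚ) * (n - 1)) / 24)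

lemma Cmat_eq [NeZero n] : Cmat n k = Sy k (C1 n) := by
  ext l m
  unfold C1
  rw [Sy_perm (fun x => -x) (fun _ => 1) l m (starTuple n k l.1)
    (stF_inv k (multCnt l.1 n)).toPerm (star_mem _ l.2) (starT_neg _ l.2) (star_stab _ l.2)]
  simp [Cmat, eq_comm]

lemma Tmat_eq [NeZero n] : Tmat n k = Sy k (Matrix.diagonal fun x => c1 n * q1 n x) := by
  ext l m
  rw [Sy_diag]
  simp only [Tmat, Matrix.of_apply]
  congr 1
  rw [Finset.prod_mul_distrib]
  congr 1
  · rw [Finset.prod_const, Finset.card_univ, Fintype.card_fin, c1, zetaPow, zetaPow, ← Complex.exp_nat_mul]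
    congr 1
    push_cast
    ring
  · refine Finset.prod_congr rfl fun i _ => ?_
    have h := ((mem_alc _).1 l.2).1 i
    unfold q1
    rcases h.2.lt_or_eq with h1 | h1
    · rw [ZMod.val_cast_of_lt h1]
    · rw [h1]; simp

lemma Smat_eq [NeZero n] : Smat n k = Sy k (S1 n) := by
  ext l m
  simp only [Smat, Sy, Matrix.of_apply]
  have hS : PP (S1 n) (zc n l.1) (zc n m.1) = (stabCard l.1 : ℂ) *
      (mEval l.1 (fun i => Complex.exp (2 * Real.pi * Complex.I / n) ^ (m.1 i : ℕ)) *
      (((Real.sqrt ((n : ℝ) ^ k) : ℝ) : ℂ))⁻¹) := by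
    have h1 : ∀ w : Equiv.Perm (Fin k), ∏ i, S1 n (zc n l.1 (w i)) (zc n m.1 i)
        = (fun a : Fin k → ℕ => (∏ i, (Complex.exp (2 * Real.pi * Complex.I / n) ^ (m.1 i : ℕ)) ^ a i) *
          (((Real.sqrt ((n : ℝ) ^ k) : ℝ) : ℂ))⁻¹) (l.1 ∘ w) := by
      intro w
      simp only [S1, Matrix.of_apply, Finset.prod_mul_distrib]
      congr 1
      · refine Finset.prod_congr rfl fun i _ => ?_
        have := ZMod.stdAddChar_coe (N := n) (l.1 (w i) * m.1 i : ℤ)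
        simp only [zc]
        push_cast at this
        rw [this, ← pow_mul, ← Complex.exp_nat_mul]
        congr 1
        simp only [Function.comp]
        push_cast
        ring
      · rw [Finset.prod_const, Finset.card_univ, Fintype.card_fin, inv_pow]
        congr 1
        rw [← Complex.ofReal_pow]
        congr 1
        rw [Real.sqrt_eq_rpow, Real.sqrt_eq_rpow, ← Real.rpow_natCast, ← Real.rpow_natCast,
          ← Real.rpow_mul (by positivity), ← Real.rpow_mul (by positivity), mul_comm]
    unfold PP
    rw [Finset.sum_congr rfl fun w _ => h1 w, Finset.sum_comp (s := univ) (fun a : Fin k → ℕ => (∏ i, (Complex.exp (2 * Real.pi * Complex.I / n) ^ (m.1 i : ℕ)) ^ a i) *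
          (((Real.sqrt ((n : ℝ) ^ k) : ℝ) : ℂ))⁻¹) (fun w : Equiv.Perm (Fin k) => l.1 ∘ w)]
    unfold mEval
    rw [Finset.sum_mul, Finset.mul_sum]
    refine Finset.sum_congr rfl fun b hb => ?_
    obtain ⟨v, -, rfl⟩ := Finset.mem_image.1 hb
    rw [count_comp, ← stab_eq, nsmul_eq_mul]
  rw [hS, Real.sqrt_div (by positivity)]
  have h2 : (stabCard l.1 : ℂ) = ((Real.sqrt (stabCard l.1 : ℝ) : ℝ) : ℂ) * ((Real.sqrt (stabCard l.1 : ℝ) : ℝ) : ℂ) := by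
    rw [← Complex.ofReal_mul, Real.mul_self_sqrt (by positivity)]; simp
  have h3 : ((Real.sqrt (stabCard l.1 : ℝ) : ℝ) : ℂ) ≠ 0 := by
    have := stab_pos l.1
    rw [Complex.ofReal_ne_zero]; positivity
  rw [h2]
  unfold rs
  push_cast
  field_simp

end Ident

section Gauss

open Filter Topology

/-- theta-like sum -/
noncomputable def JJ (s : ℂ) (x : ℝ) : ℂ :=
  ∑' m : ℤ, Complex.exp (-Real.pi * s * m ^ 2 + 2 * Real.pi * (-Complex.I * x) * m)

lemma JJ_eq (s : ℂ) (hs : 0 < s.re) (x : ℝ) :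
    ∑' m : ℤ, Complex.exp (-Real.pi / s * (m + x) ^ 2) = s ^ (1 / 2 : ℂ) * JJ s x := by
  have h0 : s ^ (1 / 2 : ℂ) ≠ 0 := by
    have : s ≠ 0 := by rintro rfl; simp at hs
    simp [Complex.cpow_eq_zero_iff, this]
  unfold JJ
  rw [Complex.tsum_exp_neg_quadratic hs, ← mul_assoc, mul_one_div_cancel h0, one_mul]
  congr 1
  funext m
  congr 3
  rw [← mul_assoc]; simp

lemma summ_sq {c : ℝ} (hc : 0 < c) : Summable fun m : ℤ => Real.exp (-Real.pi * c * (m : ℝ) ^ 2) := by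
  have h := (summable_jacobiTheta₂_term_iff 0 (c * Complex.I)).2 (by simpa using hc)
  have := h.norm
  refine this.congr fun m => ?_
  rw [norm_jacobiTheta₂_term]
  congr 1
  simp
  ring

lemma JJ_norm (s : ℂ) (x : ℝ) (m : ℤ) :
    ‖Complex.exp (-Real.pi * s * m ^ 2 + 2 * Real.pi * (-Complex.I * x) * m)‖
      = Real.exp (-Real.pi * s.re * (m : ℝ) ^ 2) := by
  rw [Complex.norm_exp]
  congr 1
  have : (-Real.pi * s * m ^ 2 + 2 * Real.pi * (-Complex.I * x) * m : ℂ)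
    = ((-Real.pi * (m : ℝ) ^ 2 : ℝ) : ℂ) * s + ((-2 * Real.pi * x * m : ℝ) : ℂ) * Complex.I := by
    push_cast; ring
  rw [this, Complex.add_re, Complex.re_ofReal_mul, Complex.re_ofReal_mul]
  simp
  ring

lemma JJ_lim (y x : ℝ) : Tendsto (fun t : ℝ => JJ (t + y * Complex.I) x) atTop (𝓝 1) := by
  have hre : ∀ t : ℝ, ((t : ℂ) + y * Complex.I).re = t := by intro t; simp
  have h1 : (1 : ℂ) = ∑' m : ℤ, if m = 0 then (1 : ℂ) else 0 := by
    rw [tsum_ite_eq]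
  rw [h1]
  unfold JJ
  apply tendsto_tsum_of_dominated_convergence (summ_sq one_pos)
  · intro m
    by_cases hm : m = 0
    · subst hm; simp
    · rw [if_neg hm, tendsto_zero_iff_norm_tendsto_zero]
      simp_rw [JJ_norm, hre]
      apply Real.tendsto_exp_atBot.comp
      have hm' : (0 : ℝ) < Real.pi * (m : ℝ) ^ 2 := by positivity
      have := tendsto_id.const_mul_atTop_of_neg (show -(Real.pi * (m : ℝ) ^ 2) < 0 by linarith)
      refine this.congr fun t => ?_
      simp only [id]; ring
  · filter_upwards [eventually_ge_atTop 1] with t ht m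
    rw [JJ_norm, hre]
    apply Real.exp_le_exp.2
    have : 0 ≤ Real.pi * (m : ℝ) ^ 2 := by positivity
    nlinarith

/-- quadratic phase on integers -/
noncomputable def qi (n : ℕ) (a : ℤ) : ℂ :=
  Complex.exp (Real.pi * Complex.I * a * (n - a) / n)

lemma qi_per (n : ℕ) (hn : n ≠ 0) (j r : ℤ) : qi n (j * n + r) = qi n r := by
  unfold qi
  rw [Complex.exp_eq_exp_iff_exists_int]
  obtain ⟨c, hc⟩ : ∃ c : ℤ, j * (1 - j) = c + c := by
    have : Even (j * (1 - j)) := by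
      rcases Int.even_or_odd j with h | h
      · exact h.mul_right _
      · exact Even.mul_left (by rcases h with ⟨d, rfl⟩; exact ⟨-d, by ring⟩) _
    exact this
  refine ⟨n * c - j * r, ?_⟩
  have hc' : (j : ℂ) * (1 - j) = c + c := by exact_mod_cast hc
  have hn' : (n : ℂ) ≠ 0 := by exact_mod_cast hn
  push_cast
  field_simp
  linear_combination (n : ℂ) ^ 2 * hc'

lemma gauss_t (n : ℕ) [NeZero n] (t : ℝ) (ht : 0 < t) :
    (t : ℂ) ^ (1 / 2 : ℂ) * ∑ r : Fin n, qi n (r : ℕ) * JJ t ((r : ℕ) / n : ℝ)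
      = 1 / (((n : ℝ) ^ 2 * t)⁻¹ + Complex.I / n) ^ (1 / 2 : ℂ) * (Complex.exp (Real.pi * Complex.I * n / 4)
        * (((t : ℂ) + ((-1 / n : ℝ) : ℂ) * Complex.I) ^ (1 / 2 : ℂ)
        * JJ ((t : ℂ) + ((-1 / n : ℝ) : ℂ) * Complex.I) (-1 / 2 : ℝ))) := by
  have hn : (n : ℂ) ≠ 0 := by exact_mod_cast NeZero.ne n
  have hnr : (0 : ℝ) < n := by exact_mod_cast Nat.pos_of_ne_zero (NeZero.ne n)
  have htc : (t : ℂ) ≠ 0 := by exact_mod_cast ht.ne'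
  set a : ℂ := (((n : ℝ) ^ 2 * t)⁻¹ + Complex.I / n : ℂ) with ha
  have hare : a.re = ((n : ℝ) ^ 2 * t)⁻¹ := by
    have : a = ((((n : ℝ) ^ 2 * t)⁻¹ : ℝ) : ℂ) + ((1 / n : ℝ) : ℂ) * Complex.I := by
      rw [ha]; push_cast; ring
    rw [this, Complex.add_re, Complex.ofReal_re, Complex.re_ofReal_mul]; simp
  have ha0 : 0 < a.re := by rw [hare]; positivity
  set s : ℂ := (t : ℂ) + ((-1 / n : ℝ) : ℂ) * Complex.I with hs
  have hsre : s.re = t := by rw [hs]; simp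
  have hs0 : s ≠ 0 := by
    intro h; rw [h] at hsre; simp at hsre; exact ht.ne hsre
  have hane : a ≠ 0 := by
    intro h; rw [h] at ha0; simp at ha0
  have main := Complex.tsum_exp_neg_quadratic ha0 (Complex.I / 2)
  have hR : ∑' m : ℤ, Complex.exp (-Real.pi / a * (m + Complex.I * (Complex.I / 2)) ^ 2)
      = Complex.exp (Real.pi * Complex.I * n / 4) * (s ^ (1 / 2 : ℂ) * JJ s (-1 / 2 : ℝ)) := by
    rw [← JJ_eq s (by rw [hsre]; exact ht), ← tsum_mul_left]
    congr 1
    funext m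
    rw [← Complex.exp_add, Complex.exp_eq_exp_iff_exists_int]
    obtain ⟨c, hc⟩ : ∃ c : ℤ, m * (m - 1) = c + c := Int.even_mul_pred_self m
    have hc' : (m : ℂ) * (m - 1) = c + c := by exact_mod_cast hc
    refine ⟨n * c, ?_⟩
    have hinv : 1 / a = - Complex.I * n + 1 / s := by
      have h1 : a * s = (t - a * (-Complex.I * n * s)) - (t - s) + 0 - s + a * s + a * (-Complex.I * n * s) := by ring
      have h2 : s = a * (-Complex.I * n * s) + a := by
        rw [ha, hs]
        push_cast
        field_simp
        ring_nf
        simp only [Complex.I_sq, show Complex.I ^ 3 = -Complex.I by rw [pow_succ, Complex.I_sq]; ring]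
        ring
      field_simp
      linear_combination h2
    have e1 : (-Real.pi / a : ℂ) = -Real.pi * (- Complex.I * n + 1 / s) := by
      rw [← hinv]; ring
    rw [e1, ← mul_div_assoc, Complex.I_mul_I]
    push_cast
    linear_combination (Real.pi * Complex.I * n : ℂ) * hc'
  have hL : ∑' m : ℤ, Complex.exp (-Real.pi * a * m ^ 2 + 2 * Real.pi * (Complex.I / 2) * m)
      = (t : ℂ) ^ (1 / 2 : ℂ) * ∑ r : Fin n, qi n (r : ℕ) * JJ t ((r : ℕ) / n : ℝ) := by
    have hterm : ∀ p : Fin n × ℤ, Complex.exp (-Real.pi * a * ((p.2 * n + (p.1 : ℕ) : ℤ) : ℂ) ^ 2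
        + 2 * Real.pi * (Complex.I / 2) * ((p.2 * n + (p.1 : ℕ) : ℤ) : ℂ))
        = qi n (p.1 : ℕ) * Complex.exp (-Real.pi / t * (p.2 + (((p.1 : ℕ) / n : ℝ) : ℂ)) ^ 2) := by
      intro p
      rw [← qi_per n (NeZero.ne n) p.2, qi, ← Complex.exp_add, ha]
      congr 1
      push_cast
      field_simp
      ring
    have hsum : Summable fun m : ℤ => Complex.exp (-Real.pi * a * m ^ 2 + 2 * Real.pi * (Complex.I / 2) * m) := by
      rw [← summable_norm_iff]
      refine (summ_sq ha0).congr fun m => ?_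
      have := JJ_norm a (-1 / 2) m
      rw [← this]
      congr 2
      push_cast; ring
    let e : Fin n × ℤ ≃ ℤ := (Equiv.prodComm _ _).trans (Int.divModEquiv n).symm
    have he : ∀ p : Fin n × ℤ, e p = p.2 * n + (p.1 : ℕ) := fun p => rfl
    rw [← e.tsum_eq, Summable.tsum_prod, tsum_fintype, Finset.mul_sum]
    · refine Finset.sum_congr rfl fun r _ => ?_
      simp_rw [he]
      rw [tsum_congr fun j => hterm (r, j)]
      simp only
      rw [tsum_mul_left, JJ_eq t (by simpa using ht)]
      ring
    · exact (e.summable_iff (f := fun m : ℤ => Complex.exp (-Real.pi * a * m ^ 2 + 2 * Real.pi * (Complex.I / 2) * m))).2 hsum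
  rw [← hL, main, hR]

lemma gauss_sum (n : ℕ) [NeZero n] :
    ∑ r : Fin n, qi n (r : ℕ) = 1 / (Complex.I / n) ^ (1 / 2 : ℂ) * Complex.exp (Real.pi * Complex.I * n / 4) := by
  have hn : (n : ℂ) ≠ 0 := by exact_mod_cast NeZero.ne n
  have hnr : (0 : ℝ) < n := by exact_mod_cast Nat.pos_of_ne_zero (NeZero.ne n)
  have hIn : Complex.I / n ∈ Complex.slitPlane := by
    right
    rw [show Complex.I / n = ((1 / n : ℝ) : ℂ) * Complex.I by push_cast; ring]
    simp [NeZero.ne n]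
  have l1 : Tendsto (fun t : ℝ => ∑ r : Fin n, qi n (r : ℕ) * JJ t ((r : ℕ) / n : ℝ)) atTop
      (𝓝 (∑ r : Fin n, qi n (r : ℕ) * 1)) := by
    apply tendsto_finsetSum
    intro r _
    have := JJ_lim 0 ((r : ℕ) / n : ℝ)
    simp only [Complex.ofReal_zero, zero_mul, add_zero] at this
    exact this.const_mul _
  have inv0 : Tendsto (fun t : ℝ => ((t⁻¹ : ℝ) : ℂ)) atTop (𝓝 0) := by
    have := (Complex.continuous_ofReal.tendsto 0).comp tendsto_inv_atTop_zero
    rw [Complex.ofReal_zero] at this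
    exact this
  have l2 : Tendsto (fun t : ℝ => 1 / ((((n : ℝ) ^ 2 * t)⁻¹ + Complex.I / n : ℂ)) ^ (1 / 2 : ℂ)) atTop
      (𝓝 (1 / (Complex.I / n) ^ (1 / 2 : ℂ))) := by
    have h1 : Tendsto (fun t : ℝ => ((((n : ℝ) ^ 2 * t)⁻¹ + Complex.I / n : ℂ))) atTop (𝓝 (Complex.I / n)) := by
      have := (inv0.const_mul (((n : ℂ) ^ 2)⁻¹)).add_const (Complex.I / n)
      rw [mul_zero, zero_add] at this
      refine this.congr fun t => ?_
      push_cast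
      rw [mul_inv]
    have h2 := h1.cpow (tendsto_const_nhds (x := (1 / 2 : ℂ))) hIn
    refine tendsto_const_nhds.div h2 ?_
    rw [Ne, Complex.cpow_eq_zero_iff]
    simp [NeZero.ne n]
  have l3 : Tendsto (fun t : ℝ => (1 + ((-1 / n : ℝ) : ℂ) * Complex.I * ((t⁻¹ : ℝ) : ℂ)) ^ (1 / 2 : ℂ)) atTop (𝓝 1) := by
    have h1 : Tendsto (fun t : ℝ => (1 + ((-1 / n : ℝ) : ℂ) * Complex.I * ((t⁻¹ : ℝ) : ℂ))) atTop (𝓝 1) := by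
      have := (inv0.const_mul (((-1 / n : ℝ) : ℂ) * Complex.I)).const_add 1
      simpa using this
    have h2 := h1.cpow (tendsto_const_nhds (x := (1 / 2 : ℂ))) (by simp)
    simpa using h2
  have l4 := l2.mul ((tendsto_const_nhds (x := Complex.exp (Real.pi * Complex.I * n / 4))).mul
    (l3.mul (JJ_lim (-1 / n) (-1 / 2))))
  simp only [mul_one] at l1 l4
  refine tendsto_nhds_unique l1 (l4.congr' ?_)
  filter_upwards [eventually_gt_atTop 0] with t ht
  have h := gauss_t n t ht
  have htc : (t : ℂ) ≠ 0 := by exact_mod_cast ht.ne'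
  have h0 : (t : ℂ) ^ (1 / 2 : ℂ) ≠ 0 := by
    rw [Ne, Complex.cpow_eq_zero_iff]; simp [htc]
  have hfac : ((t : ℂ) + ((-1 / n : ℝ) : ℂ) * Complex.I) ^ (1 / 2 : ℂ)
      = (t : ℂ) ^ (1 / 2 : ℂ) * (1 + ((-1 / n : ℝ) : ℂ) * Complex.I * ((t⁻¹ : ℝ) : ℂ)) ^ (1 / 2 : ℂ) := by
    have hu : (1 + ((-1 / n : ℝ) : ℂ) * Complex.I * ((t⁻¹ : ℝ) : ℂ)) ≠ 0 := by
      intro h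
      have := congrArg Complex.re h
      rw [show (1 + ((-1 / n : ℝ) : ℂ) * Complex.I * ((t⁻¹ : ℝ) : ℂ))
        = 1 + ((-1 / n * t⁻¹ : ℝ) : ℂ) * Complex.I by push_cast; ring,
        Complex.add_re, Complex.re_ofReal_mul] at this
      simp at this
    have hprod : ((t : ℂ) + ((-1 / n : ℝ) : ℂ) * Complex.I)
        = (t : ℂ) * (1 + ((-1 / n : ℝ) : ℂ) * Complex.I * ((t⁻¹ : ℝ) : ℂ)) := by
      push_cast; field_simp
    rw [hprod, Complex.cpow_def_of_ne_zero (mul_ne_zero htc hu), Complex.cpow_def_of_ne_zero htc,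
      Complex.cpow_def_of_ne_zero hu, Complex.log_ofReal_mul ht hu, Complex.ofReal_log ht.le,
      add_mul, Complex.exp_add]
  rw [hfac] at h
  apply mul_left_cancel₀ h0
  rw [h]
  ring

end Gauss

section Final

variable {n k : ℕ}

lemma q1_cast [NeZero n] (a : ℤ) : q1 n (a : ZMod n) = qi n a := by
  have h1 : qi n a = qi n (((a : ZMod n)).val : ℤ) := by
    rw [ZMod.val_intCast]
    conv_lhs => rw [← Int.mul_ediv_add_emod a n, mul_comm]
    exact qi_per n (NeZero.ne n) _ _
  rw [h1]
  unfold q1 qi zetaPow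
  congr 1
  push_cast
  ring

lemma q1_add [NeZero n] (x y : ZMod n) :
    q1 n (x + y) = q1 n x * q1 n y * ZMod.stdAddChar (-(x * y)) := by
  obtain ⟨a, rfl⟩ := ZMod.intCast_surjective x
  obtain ⟨b, rfl⟩ := ZMod.intCast_surjective y
  have hn : (n : ℂ) ≠ 0 := by exact_mod_cast NeZero.ne n
  rw [← Int.cast_add, ← Int.cast_mul, ← Int.cast_neg, q1_cast, q1_cast, q1_cast,
    ZMod.stdAddChar_coe]
  unfold qi
  rw [← Complex.exp_add, ← Complex.exp_add]
  congr 1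
  push_cast
  field_simp
  ring

lemma q1_zero : q1 n 0 = 1 := by simp [q1, zetaPow]

lemma q1_ne (x : ZMod n) : q1 n x ≠ 0 := Complex.exp_ne_zero _

lemma q1_neg [NeZero n] (x : ZMod n) : q1 n (-x) = q1 n x := by
  obtain ⟨a, rfl⟩ := ZMod.intCast_surjective x
  have hn : (n : ℂ) ≠ 0 := by exact_mod_cast NeZero.ne n
  rw [← Int.cast_neg, q1_cast, q1_cast]
  unfold qi
  rw [Complex.exp_eq_exp_iff_exists_int]
  refine ⟨-a, ?_⟩
  push_cast
  field_simp
  ring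

lemma q1_sq [NeZero n] (x : ZMod n) : ZMod.stdAddChar (x * x) * q1 n x = (q1 n x)⁻¹ := by
  have h := q1_add x (-x)
  rw [add_neg_cancel, q1_zero, q1_neg, mul_neg, neg_neg] at h
  apply eq_inv_of_mul_eq_one_left
  rw [h]; ring

lemma sum_q1 [NeZero n] : c1 n ^ 3 * ∑ x : ZMod n, q1 n x = ((Real.sqrt (n : ℝ) : ℝ) : ℂ) := by
  have hnr : (0 : ℝ) < n := by exact_mod_cast Nat.pos_of_ne_zero (NeZero.ne n)
  have hn : (n : ℂ) ≠ 0 := by exact_mod_cast NeZero.ne n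
  have h1 : ∑ x : ZMod n, q1 n x = ∑ r : Fin n, qi n (r : ℕ) := by
    refine Fintype.sum_equiv (ZMod.finEquiv n).symm.toEquiv _ _ (fun x => ?_)
    obtain ⟨r, rfl⟩ := (ZMod.finEquiv n).surjective x
    have hv : ((ZMod.finEquiv n) r).val = (r : ℕ) := by
      obtain _ | m := n
      · exact absurd rfl (NeZero.ne 0)
      · rfl
    have : (ZMod.finEquiv n) r = (((r : ℕ) : ℤ) : ZMod n) := by
      rw [← hv]; simp
    simp only [RingEquiv.toEquiv_eq_coe, RingEquiv.coe_toEquiv, RingEquiv.symm_apply_apply]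
    rw [this, q1_cast]
  rw [h1, gauss_sum]
  have hI : (Complex.I / n) ^ (1 / 2 : ℂ) = Complex.exp (Real.pi * Complex.I / 4) * ((Real.sqrt (n : ℝ) : ℝ) : ℂ)⁻¹ := by
    have e0 : Complex.I / n = (((n : ℝ)⁻¹ : ℝ) : ℂ) * Complex.I := by push_cast; ring
    have hne : Complex.I / n ≠ 0 := div_ne_zero Complex.I_ne_zero hn
    have h2 : Complex.exp (((Real.log (n : ℝ)⁻¹ : ℝ) : ℂ) * (1 / 2)) = ((Real.sqrt (n : ℝ) : ℝ) : ℂ)⁻¹ := by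
      rw [show ((Real.log (n : ℝ)⁻¹ : ℝ) : ℂ) * (1 / 2) = ((Real.log (n : ℝ)⁻¹ * (1 / 2) : ℝ) : ℂ) by push_cast; ring,
        ← Complex.ofReal_exp, ← Complex.ofReal_inv, ← Real.sqrt_inv, Real.sqrt_eq_rpow,
        Real.rpow_def_of_pos (by positivity)]
    rw [Complex.cpow_def_of_ne_zero hne, e0, Complex.log_ofReal_mul (by positivity) Complex.I_ne_zero,
      Complex.log_I, add_mul, Complex.exp_add, h2, mul_comm]
    congr 2
    ring
  rw [hI, c1, zetaPow, ← Complex.exp_nat_mul, one_div, mul_inv, inv_inv, ← Complex.exp_neg]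
  have h3 : Complex.exp (((3 : ℕ) : ℂ) * (2 * Real.pi * Complex.I * ((-((n : ℚ) * (n - 1)) / 24 : ℚ) : ℂ) / n))
      * (Complex.exp (-(Real.pi * Complex.I / 4)) * Complex.exp (Real.pi * Complex.I * n / 4)) = 1 := by
    rw [← Complex.exp_add, ← Complex.exp_add, ← Complex.exp_zero]
    congr 1
    push_cast
    field_simp
    ring
  linear_combination ((Real.sqrt (n : ℝ) : ℝ) : ℂ) * h3

lemma sqrt_n [NeZero n] : ((Real.sqrt (n : ℝ) : ℝ) : ℂ)⁻¹ * ((Real.sqrt (n : ℝ) : ℝ) : ℂ)⁻¹ = (n : ℂ)⁻¹ := by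
  rw [← mul_inv, ← Complex.ofReal_mul, Real.mul_self_sqrt (by positivity)]; simp

lemma sqrt_n_ne [NeZero n] : ((Real.sqrt (n : ℝ) : ℝ) : ℂ) ≠ 0 := by
  have hnr : (0 : ℝ) < n := by exact_mod_cast Nat.pos_of_ne_zero (NeZero.ne n)
  rw [Complex.ofReal_ne_zero]; positivity

lemma S1_sq [NeZero n] : S1 n * S1 n = C1 n := by
  ext x y
  have hn : (n : ℂ) ≠ 0 := by exact_mod_cast NeZero.ne n
  simp only [Matrix.mul_apply, S1, C1, Matrix.of_apply]
  have : ∀ z : ZMod n, ZMod.stdAddChar (x * z) * ((Real.sqrt (n : ℝ) : ℝ) : ℂ)⁻¹ *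
      (ZMod.stdAddChar (z * y) * ((Real.sqrt (n : ℝ) : ℝ) : ℂ)⁻¹)
      = ZMod.stdAddChar (z * (x + y)) * (n : ℂ)⁻¹ := by
    intro z
    rw [mul_add, AddChar.map_add_eq_mul, mul_comm z x, ← sqrt_n]; ring
  rw [Finset.sum_congr rfl fun z _ => this z, ← Finset.sum_mul,
    AddChar.sum_mulShift _ (ZMod.isPrimitive_stdAddChar n), ZMod.card]
  have : x + y = 0 ↔ -x = y := by rw [add_comm, add_eq_zero_iff_eq_neg, eq_comm]
  by_cases h : -x = y
  · rw [if_pos h, if_pos (this.2 h), mul_inv_cancel₀ hn]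
  · rw [if_neg h, if_neg (fun h' => h (this.1 h'))]; simp

lemma C1_sq [NeZero n] : C1 n * C1 n = 1 := by
  ext x y
  simp only [Matrix.mul_apply, C1, Matrix.one_apply, Matrix.of_apply, ite_mul, one_mul, zero_mul,
    Finset.sum_ite_eq, Finset.mem_univ, if_true, neg_neg]

lemma C1_S1 [NeZero n] : C1 n * S1 n = (S1 n)ᴴ := by
  ext x y
  simp only [Matrix.mul_apply, C1, S1, Matrix.of_apply, Matrix.conjTranspose_apply, ite_mul, one_mul, zero_mul,
    Finset.sum_ite_eq, Finset.mem_univ, if_true, star_mul', star_inv₀]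
  congr 1
  · rw [neg_mul, AddChar.map_neg_eq_conj, mul_comm]; rfl
  · congr 1; exact (Complex.conj_ofReal _).symm

lemma S1_C1 [NeZero n] : S1 n * C1 n = C1 n * S1 n := by
  rw [← S1_sq, mul_assoc]

lemma C1_diag [NeZero n] (d : ZMod n → ℂ) (hd : ∀ x, d (-x) = d x) :
    C1 n * Matrix.diagonal d = Matrix.diagonal d * C1 n := by
  ext x y
  rw [Matrix.mul_diagonal, Matrix.diagonal_mul]
  simp only [C1, Matrix.of_apply]
  split_ifs with h
  · rw [← h, hd, mul_comm]
  · simp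

lemma STS [NeZero n] (T U : Matrix (ZMod n) (ZMod n) ℂ)
    (hT : T = Matrix.diagonal fun x => c1 n * q1 n x)
    (hU : U = Matrix.diagonal fun x => (c1 n * q1 n x)⁻¹) :
    S1 n * T * S1 n = U * S1 n * U := by
  have hn : (n : ℂ) ≠ 0 := by exact_mod_cast NeZero.ne n
  have hc : c1 n ≠ 0 := Complex.exp_ne_zero _
  subst hT hU
  ext x y
  rw [Matrix.mul_diagonal, Matrix.diagonal_mul, Matrix.mul_apply]
  simp only [Matrix.mul_diagonal]
  simp only [S1, Matrix.of_apply]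
  have h1 : ∀ z : ZMod n, ZMod.stdAddChar (x * z) * ((Real.sqrt (n : ℝ) : ℝ) : ℂ)⁻¹ * (c1 n * q1 n z) *
      (ZMod.stdAddChar (z * y) * ((Real.sqrt (n : ℝ) : ℝ) : ℂ)⁻¹)
      = (ZMod.stdAddChar (z * (x + y)) * q1 n z) * (c1 n * (n : ℂ)⁻¹) := by
    intro z
    rw [mul_add, AddChar.map_add_eq_mul, mul_comm z x, ← sqrt_n]; ring
  have h2 : ∑ z : ZMod n, ZMod.stdAddChar (z * (x + y)) * q1 n z
      = (∑ z : ZMod n, q1 n z) * (q1 n (x + y))⁻¹ := by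
    rw [← Equiv.sum_comp (Equiv.addRight (x + y)), Finset.sum_mul]
    refine Finset.sum_congr rfl fun z _ => ?_
    rw [Equiv.coe_addRight, q1_add, add_mul, AddChar.map_add_eq_mul, ← q1_sq]
    have : ZMod.stdAddChar (z * (x + y)) * ZMod.stdAddChar (-(z * (x + y))) = (1 : ℂ) := by
      rw [← AddChar.map_add_eq_mul, add_neg_cancel, AddChar.map_zero_eq_one]
    linear_combination (ZMod.stdAddChar ((x + y) * (x + y)) * q1 n z * q1 n (x + y)) * this
  have h3 : (q1 n (x + y))⁻¹ = (q1 n x)⁻¹ * (q1 n y)⁻¹ * ZMod.stdAddChar (x * y) := by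
    rw [q1_add, mul_inv, mul_inv]
    congr 1
    rw [inv_eq_iff_eq_inv, ← AddChar.map_neg_eq_inv]
  have h4 : ∑ z : ZMod n, q1 n z = ((Real.sqrt (n : ℝ) : ℝ) : ℂ) * (c1 n ^ 3)⁻¹ := by
    rw [← sum_q1]; field_simp
  rw [Finset.sum_congr rfl fun z _ => h1 z, ← Finset.sum_mul, h2, h3, h4, ← sqrt_n]
  have := sqrt_n_ne (n := n)
  have := q1_ne x
  have := q1_ne y
  field_simp

lemma ST3 [NeZero n] (T : Matrix (ZMod n) (ZMod n) ℂ)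
    (hT : T = Matrix.diagonal fun x => c1 n * q1 n x) :
    S1 n * T * (S1 n * T) * (S1 n * T) = C1 n := by
  set U : Matrix (ZMod n) (ZMod n) ℂ := Matrix.diagonal fun x => (c1 n * q1 n x)⁻¹ with hU
  have hUT : U * T = 1 := by
    rw [hU, hT, Matrix.diagonal_mul_diagonal, ← Matrix.diagonal_one]
    congr 1
    funext x
    exact inv_mul_cancel₀ (mul_ne_zero (Complex.exp_ne_zero _) (q1_ne x))
  have hCT : C1 n * T = T * C1 n := by
    rw [hT]; exact C1_diag _ fun x => by rw [q1_neg]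
  calc S1 n * T * (S1 n * T) * (S1 n * T) = (S1 n * T * S1 n) * T * S1 n * T := by
        simp only [mul_assoc]
    _ = U * S1 n * (U * T) * S1 n * T := by rw [STS T U hT hU]; simp only [mul_assoc]
    _ = U * ((S1 n * S1 n) * T) := by rw [hUT, mul_one]; simp only [mul_assoc]
    _ = C1 n := by rw [S1_sq, hCT, ← mul_assoc, hUT, one_mul]

end Final

/-- the matrices `𝒮` and `𝒯` yield a representation of (the double
cover of) the modular group: `(𝒮𝒯)³ = 𝒮² = 𝒞`, `𝒞² = 1`, `𝒮` is unitary, and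
`𝒮^* = 𝒞𝒮 = 𝒮𝒞`, `𝒞𝒯𝒞 = 𝒯`. -/
theorem stmt_18 (n k : ℕ) (hn : 1 ≤ n) (hk : 1 ≤ k) :
    (Smat n k * Tmat n k) ^ 3 = Smat n k ^ 2 ∧
    Smat n k ^ 2 = Cmat n k ∧
    Cmat n k ^ 2 = 1 ∧
    Smat n k * (Smat n k)ᴴ = 1 ∧
    (Smat n k)ᴴ * Smat n k = 1 ∧
    (Smat n k)ᴴ = Cmat n k * Smat n k ∧
    (Smat n k)ᴴ = Smat n k * Cmat n k ∧
    Cmat n k * Tmat n k * Cmat n k = Tmat n k := by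
  haveI : NeZero n := ⟨by omega⟩
  have hCC : C1 n * (Matrix.diagonal fun x => c1 n * q1 n x) * C1 n = Matrix.diagonal fun x => c1 n * q1 n x := by
    rw [C1_diag _ fun x => by rw [q1_neg], mul_assoc, C1_sq, mul_one]
  have hU : (S1 n)ᴴ * S1 n = 1 := by rw [← C1_S1, mul_assoc, S1_sq, C1_sq]
  have hU' : S1 n * (S1 n)ᴴ = 1 := by rw [← C1_S1, ← mul_assoc, S1_C1, mul_assoc, S1_sq, C1_sq]
  rw [Smat_eq, Tmat_eq, Cmat_eq, pow_succ, pow_two, pow_two, pow_two, Sy_conj]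
  simp only [Sy_mul]
  rw [ST3 _ rfl, S1_sq, C1_sq, hU, hU', S1_C1, C1_S1, hCC, Sy_one]
  exact ⟨rfl, rfl, rfl, rfl, rfl, rfl, rfl, rfl⟩
end
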